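/- The relative norm map on ideals induces a surjection from the ideal class group of K onto the ideal class group of F: for every ideal class c of 𝓞_F there exists a nonzero ideal I of 𝓞_K such that the class of N_{K/F}(I) in the ideal class group of F equals c. -/

import Mathlib

open NumberField
open scoped nonZeroDivisors

/-- The relative norm ideal `N_{K/F}(𝔞)`: the ideal of `𝓞 F` generated by the relative
(field) norms of the elements of `𝔞`. -/
noncomputable def relNormIdeal (F : Type*) {K : Type*} [Field F] [Field K]
    [NumberField F] [NumberField K] [Algebra F K] (𝔞 : Ideal (𝓞 K)) : Ideal (𝓞 F) :=
  Ideal.span {y : 𝓞 F | ∃ x ∈ 𝔞, algebraMap (𝓞 F) F y = Algebra.norm F (algebraMap (𝓞 K) K x)}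

open Module IsDedekindDomain

set_option linter.unusedSectionVars false

theorem index_range_nsmul_two_congr {A B : Type*} [AddCommGroup A] [AddCommGroup B] (e : A ≃+ B) :
    (nsmulAddMonoidHom 2 : A →+ A).range.index = (nsmulAddMonoidHom 2 : B →+ B).range.index := by
  have h : (nsmulAddMonoidHom 2 : A →+ A).range =
      (nsmulAddMonoidHom 2 : B →+ B).range.comap e.toAddMonoidHom := by
    ext x
    constructor
    · rintro ⟨y, rfl⟩
      exact ⟨e y, by simp⟩
    · rintro ⟨y, hy⟩
      refine ⟨e.symm y, e.injective ?_⟩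
      simpa using hy
  rw [h, AddSubgroup.index_comap_of_surjective _ e.surjective]

theorem index_range_nsmul_two_int : (nsmulAddMonoidHom 2 : ℤ →+ ℤ).range.index = 2 := by
  have : (nsmulAddMonoidHom 2 : ℤ →+ ℤ).range = AddSubgroup.zmultiples 2 := by
    ext x
    simp [AddSubgroup.mem_zmultiples_iff, mul_comm]
  rw [this, Int.index_zmultiples]; rfl

theorem index_range_nsmul_two_pi (n : ℕ) :
    (nsmulAddMonoidHom 2 : (Fin n → ℤ) →+ (Fin n → ℤ)).range.index = 2 ^ n := by
  have : (nsmulAddMonoidHom 2 : (Fin n → ℤ) →+ (Fin n → ℤ)).range =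
      AddSubgroup.pi Set.univ fun _ ↦ (nsmulAddMonoidHom 2 : ℤ →+ ℤ).range := by
    ext x
    constructor
    · rintro ⟨y, rfl⟩ i -
      exact ⟨y i, by simp⟩
    · intro h
      choose y hy using fun i ↦ h i (Set.mem_univ i)
      exact ⟨y, funext fun i ↦ by simpa using hy i⟩
  rw [this, AddSubgroup.index_pi]
  simp [index_range_nsmul_two_int]

theorem index_range_nsmul_two_finite (T : Type*) [AddCommGroup T] [Finite T] :
    (nsmulAddMonoidHom 2 : T →+ T).range.index = Nat.card (nsmulAddMonoidHom 2 : T →+ T).ker := by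
  have h1 := (nsmulAddMonoidHom 2 : T →+ T).range.card_mul_index
  have h2 := (nsmulAddMonoidHom 2 : T →+ T).ker.card_mul_index
  rw [AddSubgroup.index_ker] at h2
  have : 0 < Nat.card (nsmulAddMonoidHom 2 : T →+ T).range := Nat.card_pos
  rw [← h1, mul_comm] at h2
  exact (Nat.eq_of_mul_eq_mul_left this h2).symm

theorem index_range_nsmul_two (A : Type*) [AddCommGroup A] [Module.Finite ℤ A] :
    (nsmulAddMonoidHom 2 : A →+ A).range.index =
      2 ^ finrank ℤ A * Nat.card (nsmulAddMonoidHom 2 : A →+ A).ker := by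
  have : AddGroup.FG A := Module.Finite.iff_addGroup_fg.mp inferInstance
  obtain ⟨n, ι, _, p, hp, k, ⟨e⟩⟩ := AddCommGroup.equiv_free_prod_directSum_zmod A
  have (i : ι) : NeZero (p i ^ k i) := ⟨pow_ne_zero _ (hp i).ne_zero⟩
  set T := DirectSum ι fun i ↦ ZMod (p i ^ k i)
  have : Finite T := Finite.of_equiv (∀ i, ZMod (p i ^ k i)) DFinsupp.equivFunOnFintype.symm
  have : Module.Finite ℤ T := Module.Finite.of_finite
  let e' : A ≃+ (Fin n → ℤ) × T :=
    e.trans ((Finsupp.linearEquivFunOnFinite ℤ ℤ (Fin n)).toAddEquiv.prodCongr (AddEquiv.refl T))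
  have hrank : finrank ℤ A = n := by
    rw [e'.toIntLinearEquiv.finrank_eq]
    have h := (LinearMap.snd ℤ (Fin n → ℤ) T).ker.finrank_quotient_add_finrank
    have h0 : finrank ℤ (((Fin n → ℤ) × T) ⧸ (LinearMap.snd ℤ (Fin n → ℤ) T).ker) = 0 := by
      rw [((LinearMap.snd ℤ (Fin n → ℤ) T).quotKerEquivOfSurjective
        LinearMap.snd_surjective).finrank_eq]
      rw [Module.finrank_eq_zero_iff_isTorsion]
      exact fun {x} ↦ ⟨⟨Nat.card T, by simpa using Nat.card_pos.ne'⟩, by simp [Submonoid.smul_def]⟩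
    rw [h0, zero_add] at h
    rw [← h, LinearMap.ker_snd, LinearMap.finrank_range_of_inj LinearMap.inl_injective]
    simp
  have hker : Nat.card (nsmulAddMonoidHom 2 : A →+ A).ker =
      Nat.card (nsmulAddMonoidHom 2 : T →+ T).ker := by
    refine Nat.card_congr (Equiv.ofBijective (fun x ↦ ⟨(e' x).2, ?_⟩) ⟨?_, ?_⟩)
    · have h : (2 : ℕ) • (x : A) = 0 := x.2
      change 2 • (e' x).2 = 0
      rw [← Prod.smul_snd, ← map_nsmul, h, map_zero]; rfl
    · have h1 (x : (nsmulAddMonoidHom 2 : A →+ A).ker) : (e' x).1 = 0 := by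
        have h : (2 : ℕ) • (x : A) = 0 := x.2
        have h' : 2 • (e' x).1 = 0 := by rw [← Prod.smul_fst, ← map_nsmul, h, map_zero]; rfl
        ext i
        simpa using congr_fun h' i
      intro x y hxy
      refine Subtype.ext (e'.injective (Prod.ext ((h1 x).trans (h1 y).symm) ?_))
      simpa using hxy
    · rintro ⟨t, ht⟩
      have ht : 2 • t = 0 := ht
      refine ⟨⟨e'.symm (0, t), ?_⟩, by simp⟩
      change 2 • e'.symm (0, t) = 0
      rw [← map_nsmul]
      simp [ht]
  rw [index_range_nsmul_two_congr e', hker, hrank, ← index_range_nsmul_two_finite T,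
    ← index_range_nsmul_two_pi n, ← AddSubgroup.index_prod]
  congr 1
  ext x
  constructor
  · rintro ⟨y, rfl⟩
    exact ⟨⟨y.1, rfl⟩, ⟨y.2, rfl⟩⟩
  · rintro ⟨⟨y, hy⟩, ⟨z, hz⟩⟩
    exact ⟨(y, z), Prod.ext hy hz⟩

/-- The subgroup of squares of elements of a subgroup. -/
abbrev Subgroup.squares {X : Type*} [CommGroup X] (H : Subgroup X) : Subgroup X :=
  H.map (powMonoidHom 2)

theorem Subgroup.squares_le {X : Type*} [CommGroup X] (H : Subgroup X) : H.squares ≤ H := by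
  rintro _ ⟨x, hx, rfl⟩
  exact pow_mem hx 2

/-- A finitely generated group of units in a field of characteristic not two which contains `-1`
has `2 ^ (rank + 1)` square classes. -/
theorem relIndex_squares_units {E : Type*} [Field E] [NeZero (2 : E)] (H : Subgroup Eˣ)
    [Module.Finite ℤ (Additive H)] (hH : -1 ∈ H) :
    H.squares.relIndex H = 2 ^ (finrank ℤ (Additive H) + 1) := by
  have h := index_range_nsmul_two (Additive H)
  have h2 : Nat.card (nsmulAddMonoidHom 2 : Additive H →+ Additive H).ker = 2 := by
    have h1 : (1 : E) ≠ -1 := fun h ↦ two_ne_zero (α := E) (by linear_combination h)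
    rw [Nat.card_eq_two_iff]
    refine ⟨0, ⟨.ofMul ⟨-1, hH⟩, ?_⟩, ?_, ?_⟩
    · change Additive.ofMul ((⟨-1, hH⟩ : H) ^ 2) = 0
      rw [ofMul_eq_zero]
      ext; simp
    · intro h
      have := congr_arg (fun x ↦ (((Additive.toMul x.1 : H) : Eˣ) : E)) h
      exact h1 (by simpa using this)
    · rw [Set.eq_univ_iff_forall]
      rintro ⟨x, hx⟩
      have hx : (Additive.toMul x : H) ^ 2 = 1 := hx
      have hx : (((Additive.toMul x : H) : Eˣ) : E) ^ 2 = 1 := by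
        have := congr_arg (fun x : H ↦ ((x : Eˣ) : E)) hx
        simpa using this
      rcases mul_self_eq_one_iff.1 ((sq _).symm.trans hx) with h | h
      · left
        refine Subtype.ext (Additive.toMul.injective (Subtype.ext (Units.ext ?_)))
        simpa using h
      · right
        refine Subtype.ext (Additive.toMul.injective (Subtype.ext (Units.ext ?_)))
        simpa using h
  rw [h2, ← pow_succ] at h
  rw [← h]
  have h3 : H.squares.subgroupOf H = (powMonoidHom 2 : H →* H).range := by
    ext x
    rw [Subgroup.mem_subgroupOf]
    constructor
    · rintro ⟨y, hy, h⟩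
      exact ⟨⟨y, hy⟩, Subtype.ext h⟩
    · rintro ⟨y, rfl⟩
      exact ⟨y, y.2, rfl⟩
  rw [Subgroup.relIndex, h3]
  rfl

theorem relIndex_norm_mul_relIndex_squares {M : Type*} [CommGroup M] (σ : M →* M)
    (hσ : ∀ x, σ (σ x) = x) (P Q : Subgroup M) (hP : ∀ x, x ∈ P ↔ σ x = x)
    (hQ : ∀ x, x ∈ Q ↔ x * σ x = 1) (h90 : ∀ x ∈ Q, ∃ y, x = y / σ y) :
    (MonoidHom.id M * σ).range.relIndex P * Q.squares.relIndex Q = P.squares.relIndex P := by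
  have hr : (MonoidHom.id M / σ).range = Q := by
    ext x
    constructor
    · rintro ⟨y, rfl⟩
      rw [hQ]
      simp [hσ]
    · intro hx
      obtain ⟨y, hy⟩ := h90 x hx
      exact ⟨y, hy.symm⟩
  have hc : P.squares.comap (MonoidHom.id M * σ) = Q.squares.comap (MonoidHom.id M / σ) := by
    ext x
    constructor
    · rintro ⟨m, hm, h⟩
      have h : m ^ 2 = x * σ x := h
      have hm : σ m = m := (hP m).1 hm
      refine ⟨x / m, (hQ _).2 ?_, ?_⟩
      · rw [map_div, hm, div_mul_div_comm, ← h, sq, div_self']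
      · change (x / m) ^ 2 = x / σ x
        rw [div_pow, h, sq, mul_div_mul_left_eq_div]
    · rintro ⟨n, hn, h⟩
      have h : n ^ 2 = x / σ x := h
      have hn : n * σ n = 1 := (hQ n).1 hn
      have hn' : σ n = n⁻¹ := (inv_eq_of_mul_eq_one_right hn).symm
      have hx : σ x = x / n ^ 2 := by rw [h, div_div_cancel]
      refine ⟨x / n, (hP _).2 ?_, ?_⟩
      · rw [map_div, hn', hx, sq]; simp [div_eq_mul_inv, mul_assoc]
      · change (x / n) ^ 2 = x * σ x
        rw [hx, div_pow, sq x, mul_div_assoc]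
  have hN : (MonoidHom.id M * σ).range ≤ P := by
    rintro _ ⟨x, rfl⟩
    rw [hP]
    simp [hσ, mul_comm]
  have hs : P.squares ≤ (MonoidHom.id M * σ).range := by
    rintro _ ⟨x, hx, rfl⟩
    refine ⟨x, ?_⟩
    simp [(hP x).1 hx, sq]
  rw [← Subgroup.relIndex_mul_relIndex _ _ _ hs hN, mul_comm]
  congr 1
  rw [← Subgroup.index_comap, hc, Subgroup.index_comap, hr]

section Ord

variable {R : Type*} [CommRing R] [IsDedekindDomain R] {E : Type*} [Field E] [Algebra R E]
  [IsFractionRing R E]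

/-- The order of a nonzero element at a prime, as an additive homomorphism. -/
noncomputable def IsDedekindDomain.HeightOneSpectrum.ord (E : Type*) [Field E] [Algebra R E]
    [IsFractionRing R E] (v : HeightOneSpectrum R) :
    Additive Eˣ →+ ℤ :=
  -(MonoidHom.toAdditiveLeft (v.valuationOfNeZero (K := E)))

theorem IsDedekindDomain.HeightOneSpectrum.valuation_eq_exp_ord (v : HeightOneSpectrum R)
    (x : Eˣ) : v.valuation E x = WithZero.exp (-(v.ord E (.ofMul x))) := by
  rw [← v.valuationOfNeZero_eq]
  simp [HeightOneSpectrum.ord, WithZero.exp]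

theorem IsDedekindDomain.HeightOneSpectrum.valuation_eq_one_iff_ord (v : HeightOneSpectrum R)
    (x : Eˣ) : v.valuation E x = 1 ↔ v.ord E (.ofMul x) = 0 := by
  rw [v.valuation_eq_exp_ord, ← WithZero.exp_zero, WithZero.exp_inj, neg_eq_zero]

theorem Set.mem_unit_iff_ord (S : Set (HeightOneSpectrum R)) (x : Eˣ) :
    x ∈ S.unit E ↔ ∀ v ∉ S, v.ord E (.ofMul x) = 0 :=
  forall₂_congr fun v _ ↦ v.valuation_eq_one_iff_ord x

end Ord

section NumberField

variable {N : Type*} [Field N] [NumberField N]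

theorem exists_ord_ne_zero (v : HeightOneSpectrum (𝓞 N)) :
    ∃ x : Nˣ, v.ord N (.ofMul x) ≠ 0 ∧ ∀ w ≠ v, w.ord N (.ofMul x) = 0 := by
  have hpow : ClassGroup.mk0 (⟨v.asIdeal, mem_nonZeroDivisors_of_ne_zero v.ne_bot⟩ ^
      Fintype.card (ClassGroup (𝓞 N))) = 1 := by rw [map_pow, pow_card_eq_one]
  rw [ClassGroup.mk0_eq_one_iff] at hpow
  obtain ⟨a, ha⟩ := hpow.principal
  have ha : v.asIdeal ^ Fintype.card (ClassGroup (𝓞 N)) = Ideal.span {a} := ha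
  have ha0 : a ≠ 0 := by
    rintro rfl
    rw [Ideal.span_singleton_eq_bot.2 rfl] at ha
    exact pow_ne_zero _ v.ne_bot ha
  have ha1 : algebraMap (𝓞 N) N a ≠ 0 := by simpa using ha0
  refine ⟨Units.mk0 _ ha1, ?_, fun w hw ↦ ?_⟩
  · rw [Ne, ← v.valuation_eq_one_iff_ord, Units.val_mk0, HeightOneSpectrum.valuation_eq_one_iff_notMem,
      not_not]
    have : a ∈ Ideal.span {a} := Ideal.mem_span_singleton_self a
    rw [← ha] at this
    exact Ideal.pow_le_self Fintype.card_ne_zero this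
  · rw [← w.valuation_eq_one_iff_ord, Units.val_mk0, HeightOneSpectrum.valuation_eq_one_iff_notMem]
    intro h
    rw [← Ideal.span_singleton_le_iff_mem, ← ha] at h
    have := w.isPrime.le_of_pow_le h
    exact hw (HeightOneSpectrum.ext ((v.isMaximal.eq_of_le w.isPrime.ne_top this).symm))

/-- The orders of an `S`-unit at the primes in `S`. -/
noncomputable def sUnitOrd (S : Set (HeightOneSpectrum (𝓞 N))) :
    Additive (S.unit N) →ₗ[ℤ] (S → ℤ) :=
  LinearMap.pi fun v ↦ ((v.1.ord N).comp (S.unit N).subtype.toAdditive).toIntLinearMap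

theorem sUnitOrd_apply (S : Set (HeightOneSpectrum (𝓞 N))) (x : Additive (S.unit N)) (v : S) :
    sUnitOrd S x v = v.1.ord N (.ofMul (x.toMul : Nˣ)) := rfl

theorem exists_unit_of_forall_ord_eq_zero (x : Nˣ)
    (hx : ∀ v : HeightOneSpectrum (𝓞 N), v.ord N (.ofMul x) = 0) :
    ∃ u : (𝓞 N)ˣ, Units.map (algebraMap (𝓞 N) N : 𝓞 N →* N) u = x := by
  simp_rw [← HeightOneSpectrum.valuation_eq_one_iff_ord] at hx
  obtain ⟨a, ha⟩ := HeightOneSpectrum.mem_integers_of_valuation_le_one N (x : N)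
    fun v ↦ (hx v).le
  obtain ⟨b, hb⟩ := HeightOneSpectrum.mem_integers_of_valuation_le_one N ((x⁻¹ : Nˣ) : N)
    fun v ↦ by rw [Units.val_inv_eq_inv_val, map_inv₀, hx v, inv_one]
  have hab : a * b = 1 := by
    apply FaithfulSMul.algebraMap_injective (𝓞 N) N
    rw [map_mul, ha, hb]; simp
  exact ⟨⟨a, b, hab, by rw [mul_comm, hab]⟩, Units.ext ha⟩

/-- The inclusion of the units in the `S`-units. -/
noncomputable def unitsToSUnit (S : Set (HeightOneSpectrum (𝓞 N))) :
    Additive (𝓞 N)ˣ →ₗ[ℤ] Additive (S.unit N) :=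
  (MonoidHom.toAdditive ((Units.map (algebraMap (𝓞 N) N : 𝓞 N →* N)).codRestrict (S.unit N)
    fun x v _ ↦ by rw [← v.valuationOfNeZero_eq, v.valuation_of_unit_eq]; rfl)).toIntLinearMap

theorem unitsToSUnit_apply (S : Set (HeightOneSpectrum (𝓞 N))) (x : Additive (𝓞 N)ˣ) :
    ((unitsToSUnit S x).toMul : Nˣ) = Units.map (algebraMap (𝓞 N) N : 𝓞 N →* N) x.toMul := rfl

theorem unitsToSUnit_injective (S : Set (HeightOneSpectrum (𝓞 N))) :
    Function.Injective (unitsToSUnit S) := by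
  intro x y h
  have h : ((unitsToSUnit S x).toMul : Nˣ) = (unitsToSUnit S y).toMul := by rw [h]
  rw [unitsToSUnit_apply, unitsToSUnit_apply] at h
  exact Additive.toMul.injective (Units.map_injective (FaithfulSMul.algebraMap_injective (𝓞 N) N) h)

theorem range_unitsToSUnit (S : Set (HeightOneSpectrum (𝓞 N))) :
    (unitsToSUnit S).range = (sUnitOrd S).ker := by
  ext x
  constructor
  · rintro ⟨u, rfl⟩
    ext v
    rw [sUnitOrd_apply, unitsToSUnit_apply]
    rw [Pi.zero_apply, ← HeightOneSpectrum.valuation_eq_one_iff_ord,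
      ← v.1.valuationOfNeZero_eq, v.1.valuation_of_unit_eq]; rfl
  · intro hx
    have hx : sUnitOrd S x = 0 := hx
    obtain ⟨u, hu⟩ := exists_unit_of_forall_ord_eq_zero (x.toMul : Nˣ) fun v ↦ by
      by_cases hv : v ∈ S
      · exact congr_fun hx ⟨v, hv⟩
      · exact (Set.mem_unit_iff_ord S _).1 x.toMul.2 v hv
    exact ⟨.ofMul u, Additive.toMul.injective (Subtype.ext hu)⟩

theorem finrank_range_sUnitOrd (S : Set (HeightOneSpectrum (𝓞 N))) [Finite S] :
    finrank ℤ (sUnitOrd S).range = Nat.card S := by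
  classical
  have := Fintype.ofFinite S
  apply le_antisymm
  · refine (Submodule.finrank_le _).trans ?_
    simp
  · choose x hx hx' using fun v : S ↦ exists_ord_ne_zero v.1
    have hmem (v : S) : x v ∈ S.unit N := (Set.mem_unit_iff_ord S _).2 fun w hw ↦
      hx' v w fun h ↦ hw (h ▸ v.2)
    let f : (S → ℤ) →ₗ[ℤ] (sUnitOrd S).range :=
      (sUnitOrd S).rangeRestrict ∘ₗ Fintype.linearCombination ℤ fun v ↦ .ofMul ⟨x v, hmem v⟩
    have hf : Function.Injective f := by
      rw [injective_iff_map_eq_zero]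
      intro n hn
      ext v
      have h : sUnitOrd S (Fintype.linearCombination ℤ
          (fun v ↦ (.ofMul ⟨x v, hmem v⟩ : Additive (S.unit N))) n) v = 0 :=
        congr_fun (congr_arg Subtype.val hn) v
      rw [Fintype.linearCombination_apply, map_sum, Finset.sum_apply] at h
      simp_rw [map_smul, Pi.smul_apply, sUnitOrd_apply, toMul_ofMul] at h
      rw [Finset.sum_eq_single v] at h
      · simpa [hx v] using h
      · intro w _ hw
        rw [hx' w v.1 fun h ↦ hw (Subtype.ext h.symm), smul_zero]
      · simp
    have := LinearMap.finrank_le_finrank_of_injective hf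
    simpa using this

instance finite_sUnit (S : Set (HeightOneSpectrum (𝓞 N))) [Finite S] :
    Module.Finite ℤ (Additive (S.unit N)) := by
  refine ⟨Submodule.fg_of_fg_map_of_fg_inf_ker (sUnitOrd S) (IsNoetherian.noetherian _) ?_⟩
  rw [top_inf_eq, ← range_unitsToSUnit, LinearMap.range_eq_map]
  exact Module.Finite.fg_top.map _

theorem finrank_sUnit (S : Set (HeightOneSpectrum (𝓞 N))) [Finite S] :
    finrank ℤ (Additive (S.unit N)) = Units.rank N + Nat.card S := by
  rw [← (sUnitOrd S).ker.finrank_quotient_add_finrank, (sUnitOrd S).quotKerEquivRange.finrank_eq,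
    finrank_range_sUnitOrd, ← range_unitsToSUnit,
    LinearMap.finrank_range_of_inj (unitsToSUnit_injective S), Units.finrank_eq, add_comm]

theorem relIndex_squares_sUnit (S : Set (HeightOneSpectrum (𝓞 N))) [Finite S] :
    (S.unit N).squares.relIndex (S.unit N) = 2 ^ (Units.rank N + Nat.card S + 1) := by
  rw [relIndex_squares_units, finrank_sUnit]
  intro v _
  simp

end NumberField

section Zeta

open Filter Topology

variable (N : Type*) [Field N] [NumberField N]

/-- The Dedekind zeta function at a real number, with values in `ENNReal`. -/
noncomputable def idealZeta (s : ℝ) : ENNReal :=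
  ∑' I : Ideal (𝓞 N), ENNReal.ofReal ((Ideal.absNorm I : ℝ) ^ (-s))

variable {N}

theorem idealZeta_eq_tsum (s : ℝ) : idealZeta N s =
    ∑' n : ℕ, ENNReal.ofReal (Nat.card {I : Ideal (𝓞 N) // Ideal.absNorm I = n} * (n : ℝ) ^ (-s)) := by
  rw [idealZeta, ← (Equiv.sigmaFiberEquiv (Ideal.absNorm (S := 𝓞 N))).tsum_eq,
    ENNReal.tsum_sigma']
  congr 1
  ext n
  have : Finite {I : Ideal (𝓞 N) // Ideal.absNorm I = n} := Ideal.finite_setOfPred_absNorm_eq n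
  have h (I : {I : Ideal (𝓞 N) // Ideal.absNorm I = n}) :
      ENNReal.ofReal ((Ideal.absNorm (Equiv.sigmaFiberEquiv (Ideal.absNorm (S := 𝓞 N)) ⟨n, I⟩) : ℝ) ^ (-s)) =
      ENNReal.ofReal ((n : ℝ) ^ (-s)) := by
    simp [Equiv.sigmaFiberEquiv, I.2]
  simp_rw [h]
  rw [ENNReal.tsum_const, ENNReal.ofReal_mul (by positivity), ENNReal.ofReal_natCast,
    ENat.card_eq_coe_natCard]
  rfl

theorem lseries_term_eq (f : ℕ → ℕ) {s : ℝ} (hs : s ≠ 0) (n : ℕ) :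
    LSeries.term (fun n ↦ (f n : ℂ)) s n = ((f n * (n : ℝ) ^ (-s) : ℝ) : ℂ) := by
  rcases eq_or_ne n 0 with rfl | hn
  · simp [Real.zero_rpow (neg_ne_zero.2 hs)]
  · rw [LSeries.term_of_ne_zero hn, Complex.ofReal_mul, Complex.ofReal_cpow (by positivity),
      Complex.ofReal_neg, Complex.cpow_neg]
    simp [div_eq_mul_inv]

theorem dedekindZeta_eq_tsum {s : ℝ} (hs : s ≠ 0) : dedekindZeta N s =
    ((∑' n : ℕ, Nat.card {I : Ideal (𝓞 N) // Ideal.absNorm I = n} * (n : ℝ) ^ (-s) : ℝ) : ℂ) := by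
  rw [dedekindZeta, LSeries, Complex.ofReal_tsum]
  exact tsum_congr fun n ↦ lseries_term_eq _ hs n

theorem idealZeta_of_dedekindZeta_ne_zero {s : ℝ} (hs : s ≠ 0) (h : dedekindZeta N s ≠ 0) :
    idealZeta N s ≠ ⊤ ∧ ((idealZeta N s).toReal : ℂ) = dedekindZeta N s := by
  rw [dedekindZeta_eq_tsum hs] at h ⊢
  have hsum := not_imp_comm.1 tsum_eq_zero_of_not_summable (Complex.ofReal_ne_zero.1 h)
  rw [idealZeta_eq_tsum, ← ENNReal.ofReal_tsum_of_nonneg (fun n ↦ by positivity) hsum]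
  refine ⟨ENNReal.ofReal_ne_top, ?_⟩
  rw [ENNReal.toReal_ofReal (tsum_nonneg fun n ↦ by positivity)]

theorem tendsto_sub_one_mul_idealZeta :
    (∀ᶠ s : ℝ in 𝓝[>] 1, idealZeta N s ≠ ⊤) ∧
    Tendsto (fun s : ℝ ↦ (s - 1) * (idealZeta N s).toReal) (𝓝[>] 1) (𝓝 (dedekindZeta_residue N)) := by
  have h := tendsto_sub_one_mul_dedekindZeta_nhdsGT N
  have h0 : ∀ᶠ s : ℝ in 𝓝[>] 1, (s - 1) * dedekindZeta N s ≠ 0 :=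
    h.eventually_ne (Complex.ofReal_ne_zero.2 (dedekindZeta_residue_ne_zero N))
  have h1 : ∀ᶠ s : ℝ in 𝓝[>] 1, idealZeta N s ≠ ⊤ ∧
      ((idealZeta N s).toReal : ℂ) = dedekindZeta N s := by
    filter_upwards [h0, self_mem_nhdsWithin] with s hs hs1
    exact idealZeta_of_dedekindZeta_ne_zero (by have : (1:ℝ) < s := hs1; positivity)
      (right_ne_zero_of_mul hs)
  refine ⟨h1.mono fun s hs ↦ hs.1, ?_⟩
  have h2 : Tendsto (fun s : ℝ ↦ (((s - 1) * (idealZeta N s).toReal : ℝ) : ℂ)) (𝓝[>] 1)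
      (𝓝 (dedekindZeta_residue N)) := by
    refine h.congr' (h1.mono fun s hs ↦ ?_)
    rw [← hs.2]; push_cast; rfl
  exact_mod_cast (Complex.continuous_re.tendsto _).comp h2

/-- The part of the zeta function coming from ideals without prime factors in a finite set. -/
noncomputable def idealZetaAway (S : Finset (HeightOneSpectrum (𝓞 N))) (s : ℝ) : ENNReal :=
  ∑' I : {I : Ideal (𝓞 N) // I ≠ 0 ∧ ∀ v ∈ S, ¬ I ≤ v.asIdeal},
    ENNReal.ofReal ((Ideal.absNorm (I : Ideal (𝓞 N)) : ℝ) ^ (-s))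

theorem two_le_absNorm (v : HeightOneSpectrum (𝓞 N)) : 2 ≤ Ideal.absNorm v.asIdeal := by
  have h0 : Ideal.absNorm v.asIdeal ≠ 0 := Ideal.absNorm_eq_zero_iff.not.2 v.ne_bot
  have h1 : Ideal.absNorm v.asIdeal ≠ 1 := Ideal.absNorm_eq_one_iff.not.2 v.isPrime.ne_top
  omega

theorem idealZetaAway_le_insert [DecidableEq (HeightOneSpectrum (𝓞 N))]
    (S : Finset (HeightOneSpectrum (𝓞 N))) (v : HeightOneSpectrum (𝓞 N)) {s : ℝ} (hs : 1 ≤ s)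
    (hfin : idealZetaAway S s ≠ ⊤) :
    idealZetaAway S s ≤ 2 * idealZetaAway (insert v S) s := by
  set f : Ideal (𝓞 N) → ENNReal := fun I ↦ ENNReal.ofReal ((Ideal.absNorm I : ℝ) ^ (-s)) with hf
  let A (S : Finset (HeightOneSpectrum (𝓞 N))) : Set (Ideal (𝓞 N)) :=
    {I | I ≠ 0 ∧ ∀ v ∈ S, ¬ I ≤ v.asIdeal}
  have hfA (S) : idealZetaAway S s = ∑' I : A S, f I := rfl
  have hsub : A S ⊆ A (insert v S) ∪ (fun J ↦ v.asIdeal * J) '' A S := by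
    intro I hI
    by_cases hv : I ≤ v.asIdeal
    · right
      obtain ⟨J, rfl⟩ := Ideal.dvd_iff_le.2 hv
      refine ⟨J, ⟨right_ne_zero_of_mul hI.1, fun w hw hJ ↦ hI.2 w hw (Ideal.mul_le_right.trans hJ)⟩, rfl⟩
    · left
      refine ⟨hI.1, fun w hw ↦ ?_⟩
      rcases Finset.mem_insert.1 hw with rfl | hw
      exacts [hv, hI.2 w hw]
  have himage : ∑' I : (fun J ↦ v.asIdeal * J) '' A S, f I ≤ 2⁻¹ * ∑' I : A S, f I := by
    have hinj : Set.InjOn (fun J ↦ v.asIdeal * J) (A S) :=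
      fun I _ J _ h ↦ mul_left_cancel₀ v.ne_bot h
    rw [tsum_image f hinj, ← ENNReal.tsum_mul_left]
    refine ENNReal.tsum_le_tsum fun J ↦ ?_
    rw [hf]
    simp only [map_mul, Nat.cast_mul]
    rw [Real.mul_rpow (by positivity) (by positivity), ENNReal.ofReal_mul (by positivity)]
    gcongr
    rw [← ENNReal.ofReal_ofNat 2, ← ENNReal.ofReal_inv_of_pos (by norm_num)]
    apply ENNReal.ofReal_le_ofReal
    have h2 : (2 : ℝ) ≤ Ideal.absNorm v.asIdeal := by exact_mod_cast two_le_absNorm v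
    calc (Ideal.absNorm v.asIdeal : ℝ) ^ (-s) ≤ (Ideal.absNorm v.asIdeal : ℝ) ^ (-1 : ℝ) :=
          Real.rpow_le_rpow_of_exponent_le (by linarith) (by linarith)
      _ = (Ideal.absNorm v.asIdeal : ℝ)⁻¹ := Real.rpow_neg_one _
      _ ≤ 2⁻¹ := by gcongr
  have key : idealZetaAway S s ≤ idealZetaAway (insert v S) s + 2⁻¹ * idealZetaAway S s := by
    rw [hfA, hfA]
    calc ∑' I : A S, f I ≤ ∑' I : ↑(A (insert v S) ∪ (fun J ↦ v.asIdeal * J) '' A S), f I :=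
          ENNReal.tsum_mono_subtype f hsub
      _ ≤ _ := (ENNReal.tsum_union_le f _ _).trans (by gcongr)
  generalize idealZetaAway S s = a at *
  generalize idealZetaAway (insert v S) s = b at *
  rcases eq_or_ne b ⊤ with rfl | hb
  · simp
  lift a to NNReal using hfin
  lift b to NNReal using hb
  have h2 : (2 : ENNReal)⁻¹ = ((2⁻¹ : NNReal) : ENNReal) := by simp
  rw [h2] at key
  norm_cast at key ⊢
  rw [← NNReal.coe_le_coe] at key ⊢
  push_cast at key ⊢
  linarith

theorem idealZeta_le_idealZetaAway (S : Finset (HeightOneSpectrum (𝓞 N))) {s : ℝ} (hs : 1 ≤ s)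
    (hfin : idealZeta N s ≠ ⊤) :
    idealZeta N s ≤ 2 ^ S.card * idealZetaAway S s := by
  classical
  have hle (S : Finset (HeightOneSpectrum (𝓞 N))) : idealZetaAway S s ≤ idealZeta N s :=
    ENNReal.tsum_comp_le_tsum_of_injective Subtype.val_injective _
  induction S using Finset.induction_on with
  | empty =>
    rw [Finset.card_empty, pow_zero, one_mul, idealZeta]
    refine (tsum_subtype_eq_of_support_subset (s := {I : Ideal (𝓞 N) | I ≠ 0 ∧
      ∀ v ∈ (∅ : Finset (HeightOneSpectrum (𝓞 N))), ¬ I ≤ v.asIdeal}) fun I hI ↦ ?_).ge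
    refine ⟨?_, by simp⟩
    rintro rfl
    apply hI
    simp [Real.zero_rpow (neg_ne_zero.2 (zero_lt_one.trans_le hs).ne')]
  | insert v S hv ih =>
    rw [Finset.card_insert_of_notMem hv, pow_succ, mul_assoc]
    refine ih.trans ?_
    gcongr
    exact idealZetaAway_le_insert S v hs ((hle S).trans_lt hfin.lt_top).ne


theorem absNorm_eq_prod_normalizedFactors {I : Ideal (𝓞 N)} (hI : I ≠ 0) :
    Ideal.absNorm I = ((UniqueFactorizationMonoid.normalizedFactors I).map Ideal.absNorm).prod := by
  conv_lhs => rw [← Ideal.prod_normalizedFactors_eq_self hI]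
  exact map_multiset_prod _ _

theorem idealZetaAway_sq_le {L : Type*} [Field L] [NumberField L] [Algebra N L]
    (S : Finset (HeightOneSpectrum (𝓞 N))) (p p' : Ideal (𝓞 N) → Ideal (𝓞 L))
    (hp : ∀ v ∉ S, (p v.asIdeal).IsPrime ∧ (p v.asIdeal).under (𝓞 N) = v.asIdeal ∧
      Ideal.absNorm (p v.asIdeal) = Ideal.absNorm v.asIdeal)
    (hp' : ∀ v ∉ S, (p' v.asIdeal).IsPrime ∧ (p' v.asIdeal).under (𝓞 N) = v.asIdeal ∧
      Ideal.absNorm (p' v.asIdeal) = Ideal.absNorm v.asIdeal)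
    (hne : ∀ v ∉ S, p v.asIdeal ≠ p' v.asIdeal) (s : ℝ) :
    idealZetaAway S s ^ 2 ≤ idealZeta L s := by
  classical
  let A := {I : Ideal (𝓞 N) // I ≠ 0 ∧ ∀ v ∈ S, ¬ I ≤ v.asIdeal}
  let nf (I : A) : Multiset (Ideal (𝓞 N)) := UniqueFactorizationMonoid.normalizedFactors I.1
  have hnf (I : A) (q) (hq : q ∈ nf I) : ∃ v ∉ S, v.asIdeal = q := by
    have h := UniqueFactorizationMonoid.prime_of_normalized_factor q hq
    refine ⟨⟨q, Ideal.isPrime_of_prime h, h.ne_zero⟩, fun hS ↦ I.2.2 _ hS ?_, rfl⟩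
    exact Ideal.le_of_dvd (UniqueFactorizationMonoid.dvd_of_mem_normalizedFactors hq)
  have hprime (I : A) (p : Ideal (𝓞 N) → Ideal (𝓞 L))
    (hp : ∀ v ∉ S, (p v.asIdeal).IsPrime ∧ (p v.asIdeal).under (𝓞 N) = v.asIdeal ∧
      Ideal.absNorm (p v.asIdeal) = Ideal.absNorm v.asIdeal) (P) (hP : P ∈ (nf I).map p) :
      Prime P := by
    obtain ⟨q, hq, rfl⟩ := Multiset.mem_map.1 hP
    obtain ⟨v, hv, rfl⟩ := hnf I q hq
    refine (Ideal.prime_iff_isPrime fun h ↦ ?_).2 (hp v hv).1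
    have := (hp v hv).2.2
    rw [h, Ideal.absNorm_bot] at this
    have := two_le_absNorm v
    omega
  have hnorm (I : A) (p : Ideal (𝓞 N) → Ideal (𝓞 L))
    (hp : ∀ v ∉ S, (p v.asIdeal).IsPrime ∧ (p v.asIdeal).under (𝓞 N) = v.asIdeal ∧
      Ideal.absNorm (p v.asIdeal) = Ideal.absNorm v.asIdeal) :
      Ideal.absNorm ((nf I).map p).prod = Ideal.absNorm I.1 := by
    rw [map_multiset_prod, absNorm_eq_prod_normalizedFactors I.2.1, Multiset.map_map]
    refine congr_arg _ (Multiset.map_congr rfl fun q hq ↦ ?_)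
    obtain ⟨v, hv, rfl⟩ := hnf I q hq
    exact (hp v hv).2.2
  let Φ (x : A × A) : Ideal (𝓞 L) := ((nf x.1).map p).prod * ((nf x.2).map p').prod
  have hΦ (x : A × A) : UniqueFactorizationMonoid.normalizedFactors (Φ x) =
      (nf x.1).map p + (nf x.2).map p' := by
    have : Φ x = ((nf x.1).map p + (nf x.2).map p').prod := (Multiset.prod_add _ _).symm
    rw [this, UniqueFactorizationMonoid.normalizedFactors_prod_of_prime]
    intro P hP
    rcases Multiset.mem_add.1 hP with h | h
    exacts [hprime _ p hp P h, hprime _ p' hp' P h]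
  have hrec (M M' : A) (p p' : Ideal (𝓞 N) → Ideal (𝓞 L))
      (hp : ∀ v ∉ S, (p v.asIdeal).under (𝓞 N) = v.asIdeal)
      (hp' : ∀ v ∉ S, (p' v.asIdeal).under (𝓞 N) = v.asIdeal)
      (hne : ∀ v ∉ S, p v.asIdeal ≠ p' v.asIdeal) :
      (((nf M).map p + (nf M').map p').filter fun P ↦ P = p (P.under (𝓞 N))).map
        (Ideal.under (𝓞 N)) = nf M := by
    rw [Multiset.filter_add, Multiset.filter_eq_self.2, Multiset.filter_eq_nil.2, add_zero,
      Multiset.map_map]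
    · conv_rhs => rw [← Multiset.map_id (nf M)]
      refine Multiset.map_congr rfl fun q hq ↦ ?_
      obtain ⟨v, hv, rfl⟩ := hnf M q hq
      exact hp v hv
    · intro P hP
      obtain ⟨q, hq, rfl⟩ := Multiset.mem_map.1 hP
      obtain ⟨v, hv, rfl⟩ := hnf M' q hq
      rw [hp' v hv]
      exact (hne v hv).symm
    · intro P hP
      obtain ⟨q, hq, rfl⟩ := Multiset.mem_map.1 hP
      obtain ⟨v, hv, rfl⟩ := hnf M q hq
      rw [hp v hv]
  have hnfinj : Function.Injective nf := fun I J h ↦ Subtype.ext <| by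
    rw [← Ideal.prod_normalizedFactors_eq_self I.2.1, ← Ideal.prod_normalizedFactors_eq_self J.2.1]
    exact congr_arg _ h
  have hinj : Function.Injective Φ := by
    intro x y hxy
    have h := congr_arg UniqueFactorizationMonoid.normalizedFactors hxy
    rw [hΦ, hΦ] at h
    refine Prod.ext (hnfinj ?_) (hnfinj ?_)
    · rw [← hrec x.1 x.2 p p' (fun v hv ↦ (hp v hv).2.1) (fun v hv ↦ (hp' v hv).2.1) hne, h,
        hrec y.1 y.2 p p' (fun v hv ↦ (hp v hv).2.1) (fun v hv ↦ (hp' v hv).2.1) hne]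
    · rw [add_comm, add_comm ((nf y.1).map p)] at h
      rw [← hrec x.2 x.1 p' p (fun v hv ↦ (hp' v hv).2.1) (fun v hv ↦ (hp v hv).2.1)
        (fun v hv ↦ (hne v hv).symm), h, hrec y.2 y.1 p' p (fun v hv ↦ (hp' v hv).2.1)
        (fun v hv ↦ (hp v hv).2.1) (fun v hv ↦ (hne v hv).symm)]
  calc idealZetaAway S s ^ 2 = ∑' x : A × A, ENNReal.ofReal ((Ideal.absNorm (Φ x) : ℝ) ^ (-s)) := by
        rw [sq, idealZetaAway, ENNReal.tsum_prod', ← ENNReal.tsum_mul_right]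
        refine tsum_congr fun I ↦ ?_
        rw [← ENNReal.tsum_mul_left]
        refine tsum_congr fun J ↦ ?_
        rw [map_mul, hnorm I p hp, hnorm J p' hp', Nat.cast_mul,
          Real.mul_rpow (by positivity) (by positivity), ENNReal.ofReal_mul (by positivity)]
    _ ≤ idealZeta L s := ENNReal.tsum_comp_le_tsum_of_injective hinj _

/-- Not almost all primes of a number field can split in an extension. -/
theorem not_forall_exists_split {L : Type*} [Field L] [NumberField L] [Algebra N L]
    (S : Finset (HeightOneSpectrum (𝓞 N))) (p p' : Ideal (𝓞 N) → Ideal (𝓞 L))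
    (hp : ∀ v ∉ S, (p v.asIdeal).IsPrime ∧ (p v.asIdeal).under (𝓞 N) = v.asIdeal ∧
      Ideal.absNorm (p v.asIdeal) = Ideal.absNorm v.asIdeal)
    (hp' : ∀ v ∉ S, (p' v.asIdeal).IsPrime ∧ (p' v.asIdeal).under (𝓞 N) = v.asIdeal ∧
      Ideal.absNorm (p' v.asIdeal) = Ideal.absNorm v.asIdeal)
    (hne : ∀ v ∉ S, p v.asIdeal ≠ p' v.asIdeal) : False := by
  obtain ⟨hN, hN'⟩ := tendsto_sub_one_mul_idealZeta (N := N)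
  obtain ⟨hL, hL'⟩ := tendsto_sub_one_mul_idealZeta (N := L)
  have hs0 : Tendsto (fun s : ℝ ↦ s - 1) (𝓝[>] 1) (𝓝 0) := by
    have : Tendsto (fun s : ℝ ↦ s - 1) (𝓝 1) (𝓝 (1 - 1)) := (continuous_sub_right 1).tendsto 1
    rw [sub_self] at this
    exact this.mono_left nhdsWithin_le_nhds
  have h1 := (hN'.pow 2)
  have h2 := (hs0.mul hL').const_mul ((2 ^ S.card) ^ 2)
  have hle : dedekindZeta_residue N ^ 2 ≤ (2 ^ S.card) ^ 2 * (0 * dedekindZeta_residue L) := by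
    refine le_of_tendsto_of_tendsto h1 h2 ?_
    filter_upwards [hN, hL, self_mem_nhdsWithin] with s hsN hsL hs
    have hs : 1 < s := hs
    have h := (pow_le_pow_left₀ (by positivity) (idealZeta_le_idealZetaAway S hs.le hsN) 2)
    rw [mul_pow] at h
    replace h := h.trans (mul_le_mul_right (idealZetaAway_sq_le S p p' hp hp' hne s) _)
    have h := ENNReal.toReal_mono (ENNReal.mul_ne_top (by simp) hsL) h
    rw [ENNReal.toReal_mul, ENNReal.toReal_pow, ENNReal.toReal_pow, ENNReal.toReal_pow,
      ENNReal.toReal_ofNat] at h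
    calc ((s - 1) * (idealZeta N s).toReal) ^ 2 = (s - 1) ^ 2 * (idealZeta N s).toReal ^ 2 := by ring
      _ ≤ (s - 1) ^ 2 * ((2 ^ S.card) ^ 2 * (idealZeta L s).toReal) := by gcongr
      _ = _ := by ring
  have := pow_pos (dedekindZeta_residue_pos N) 2
  linarith

end Zeta

section QuadraticExtension

universe u
theorem exists_quadratic_extension (N : Type u) [Field N] [NumberField N] {c : N}
    (hc : ¬ IsSquare c) : ∃ (L : Type u) (_ : Field L) (_ : NumberField L) (_ : Algebra N L)
      (θ : L), Algebra.IsQuadraticExtension N L ∧ θ ^ 2 = algebraMap N L c := by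
  have : Fact (∀ r : N, r ^ 2 ≠ c + 0 * r) := ⟨fun r hr ↦ hc ⟨r, by rw [← sq, hr]; ring⟩⟩
  have : CharZero (QuadraticAlgebra N c 0) := charZero_of_injective_algebraMap
    (QuadraticAlgebra.algebraMap_injective (R := N) (a := c) (b := 0))
  refine ⟨QuadraticAlgebra N c 0, inferInstance, ?_, inferInstance, QuadraticAlgebra.omega, ?_, ?_⟩
  · have : FiniteDimensional ℚ (QuadraticAlgebra N c 0) := FiniteDimensional.trans ℚ N _
    exact ⟨⟩
  · exact ⟨QuadraticAlgebra.finrank_eq_two _ _⟩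
  · rw [sq, QuadraticAlgebra.omega_mul_omega_eq_mk]; rfl

variable {N L : Type*} [Field N] [NumberField N] [Field L] [NumberField L] [Algebra N L]
  [Algebra.IsQuadraticExtension N L] {θ : L} {c : N}

theorem notMem_range_of_sq_eq (hc : ¬ IsSquare c) (hθ : θ ^ 2 = algebraMap N L c) (x : N) :
    algebraMap N L x ≠ θ := by
  rintro rfl
  rw [← map_pow] at hθ
  exact hc ⟨x, by rw [← sq, (algebraMap N L).injective hθ]⟩

theorem exists_eq_add_mul (hc : ¬ IsSquare c) (hθ : θ ^ 2 = algebraMap N L c) (x : L) :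
    ∃ a b : N, x = algebraMap N L a + algebraMap N L b * θ := by
  have hli : LinearIndependent N ![1, θ] := by
    rw [LinearIndependent.pair_iff' one_ne_zero]
    intro a h
    exact notMem_range_of_sq_eq hc hθ a (by rw [← h, Algebra.smul_def, mul_one])
  have htop := hli.span_eq_top_of_card_eq_finrank (by simp [Algebra.IsQuadraticExtension.finrank_eq_two])
  have hx : x ∈ Submodule.span N (Set.range ![1, θ]) := htop ▸ Submodule.mem_top
  rw [Matrix.range_cons, Matrix.range_cons, Matrix.range_empty, Set.union_empty,
    Set.singleton_union, Submodule.mem_span_pair] at hx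
  obtain ⟨a, b, rfl⟩ := hx
  exact ⟨a, b, by simp [Algebra.smul_def]⟩

theorem exists_algEquiv_apply_eq_neg (hc : ¬ IsSquare c) (hθ : θ ^ 2 = algebraMap N L c) :
    ∃ σ : Gal(L/N), σ θ = -θ := by
  by_contra! h
  have h1 (σ : Gal(L/N)) : σ θ = θ := by
    have : (σ θ) ^ 2 = θ ^ 2 := by rw [← map_pow, hθ, AlgEquiv.commutes]
    exact (sq_eq_sq_iff_eq_or_eq_neg.1 this).resolve_right (h σ)
  obtain ⟨a, ha⟩ := (IsGalois.mem_bot_iff_fixed (F := N) θ).2 h1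
  exact notMem_range_of_sq_eq hc hθ a ha

theorem algEquiv_apply_add_mul {σ : Gal(L/N)} (hσ : σ θ = -θ) (a b : N) :
    σ (algebraMap N L a + algebraMap N L b * θ) = algebraMap N L a - algebraMap N L b * θ := by
  simp [hσ, sub_eq_add_neg]


theorem absNorm_eq_of_ne {P P' : Ideal (𝓞 L)} {Q : Ideal (𝓞 N)} (hQ : Q ≠ ⊥) [hQp : Q.IsPrime]
    [P.IsPrime] [P'.IsPrime] (hP : P.under (𝓞 N) = Q) (hP' : P'.under (𝓞 N) = Q) (hne : P ≠ P') :
    Ideal.absNorm P = Ideal.absNorm Q := by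
  have : P.LiesOver Q := ⟨hP.symm⟩
  have : P'.LiesOver Q := ⟨hP'.symm⟩
  have := hQp.isMaximal hQ
  have h := Ideal.ncard_primesOver_mul_ramificationIdxIn_mul_inertiaDegIn Q (𝓞 L) Gal(L/N)
  have hc : Nat.card Gal(L/N) = 2 := by
    rw [IsGalois.card_aut_eq_finrank, Algebra.IsQuadraticExtension.finrank_eq_two]
  rw [hc, Ideal.inertiaDegIn_eq_inertiaDeg Q P Gal(L/N)] at h
  have h2 : 2 ≤ (Q.primesOver (𝓞 L)).ncard := by
    have hs : ({P, P'} : Set (Ideal (𝓞 L))) ⊆ Q.primesOver (𝓞 L) := by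
      rintro x (rfl | rfl)
      · exact ⟨inferInstance, inferInstance⟩
      · exact ⟨inferInstance, inferInstance⟩
    rw [← Set.ncard_pair hne]
    exact Set.ncard_le_ncard hs 
      (IsDedekindDomain.primesOver_finite Q (𝓞 L))
  have h3 : P.inertiaDeg (𝓞 N) = 1 := by
    have : 0 < Q.ramificationIdxIn (𝓞 L) * P.inertiaDeg (𝓞 N) := by
      refine Nat.pos_of_ne_zero fun h0 ↦ ?_
      rw [h0, mul_zero] at h
      exact two_ne_zero h.symm
    have h1 : Q.ramificationIdxIn (𝓞 L) * P.inertiaDeg (𝓞 N) = 1 := by nlinarith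
    exact Nat.eq_one_of_mul_eq_one_left h1
  rw [← Ideal.absNorm_pow_inertiaDeg Q P, h3, pow_one]

theorem exists_height_one_forall_sq_sub_notMem (S : Finset (HeightOneSpectrum (𝓞 N))) {u : 𝓞 N}
    (hu : ¬ IsSquare (u : N)) : ∃ v ∉ S, ∀ a : 𝓞 N, a ^ 2 - u ∉ v.asIdeal := by
  classical
  by_contra! H
  obtain ⟨L, _, _, _, θ, _, hθ⟩ := exists_quadratic_extension N hu
  obtain ⟨σ, hσ⟩ := exists_algEquiv_apply_eq_neg hu hθ
  have hint : IsIntegral ℤ θ := by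
    refine IsIntegral.of_pow (n := 2) two_pos ?_
    rw [hθ]
    exact (RingOfIntegers.isIntegral_coe u).algebraMap
  let ϑ : 𝓞 L := ⟨θ, hint⟩
  let τ : 𝓞 L ≃ₐ[𝓞 N] 𝓞 L := galRestrict (𝓞 N) N L (𝓞 L) σ
  have hτ : τ ϑ = -ϑ := by
    apply RingOfIntegers.ext
    refine (algebraMap_galRestrict_apply (𝓞 N) σ ϑ).trans (hσ.trans ?_)
    rfl
  have hϑ : ϑ ^ 2 = algebraMap (𝓞 N) (𝓞 L) u := by
    apply RingOfIntegers.ext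
    exact hθ
  have hu0 : (2 * u : 𝓞 N) ≠ 0 := by
    rintro h
    obtain h | rfl := mul_eq_zero.1 h
    · exact two_ne_zero h
    · exact hu ⟨0, by simp⟩
  have hfin : {v : HeightOneSpectrum (𝓞 N) | 2 * u ∈ v.asIdeal}.Finite := by
    refine (Ideal.finite_factors (I := Ideal.span {2 * u}) (by simpa using hu0)).subset ?_
    intro v hv
    simpa [Ideal.dvd_span_singleton] using hv
  have key : ∀ v ∉ S ∪ hfin.toFinset, ∃ P P' : Ideal (𝓞 L), P.IsPrime ∧ P'.IsPrime ∧
      P.under (𝓞 N) = v.asIdeal ∧ P'.under (𝓞 N) = v.asIdeal ∧ P ≠ P' := by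
    intro v hv
    simp only [Finset.mem_union, Set.Finite.mem_toFinset, Set.mem_ofPred_eq, not_or] at hv
    obtain ⟨P, hP, hPv⟩ := Ideal.exists_maximal_ideal_liesOver_of_isIntegral (S := 𝓞 L) v.asIdeal
    refine ⟨P, P.comap τ, inferInstance, inferInstance, hPv.over.symm, ?_, ?_⟩
    · rw [hPv.over]
      ext x
      simp [Ideal.mem_comap]
    · intro h
      obtain ⟨a, ha⟩ := H v hv.1
      have h1 : (algebraMap (𝓞 N) (𝓞 L) a - ϑ) * (algebraMap (𝓞 N) (𝓞 L) a + ϑ) ∈ P := by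
        have : (algebraMap (𝓞 N) (𝓞 L) a - ϑ) * (algebraMap (𝓞 N) (𝓞 L) a + ϑ) =
          algebraMap (𝓞 N) (𝓞 L) (a ^ 2 - u) := by rw [map_sub, ← hϑ, map_pow]; ring
        rw [this]
        have h2 := hPv.over ▸ ha
        exact h2
      have h2 (x) (hx : x ∈ P) : τ x ∈ P := by rw [h] at hx; exact hx
      have h3 : 2 * ϑ ∈ P := by
        obtain h1 | h1 := Ideal.IsPrime.mem_or_mem inferInstance h1
        · have := P.sub_mem (h2 _ h1) h1
          simp only [map_sub, hτ, AlgEquiv.commutes] at this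
          convert this using 1; ring
        · have := P.sub_mem h1 (h2 _ h1)
          simp only [map_add, hτ, AlgEquiv.commutes] at this
          convert this using 1; ring
      apply hv.2
      rw [hPv.over]
      change algebraMap (𝓞 N) (𝓞 L) (2 * u) ∈ P
      have := P.mul_mem_right ϑ h3
      rwa [mul_assoc, ← sq, hϑ, ← map_ofNat (algebraMap (𝓞 N) (𝓞 L)) 2, ← map_mul] at this
  have key' : ∀ I : Ideal (𝓞 N), ∃ P P' : Ideal (𝓞 L), ∀ v ∉ S ∪ hfin.toFinset, v.asIdeal = I →
      P.IsPrime ∧ P'.IsPrime ∧ P.under (𝓞 N) = I ∧ P'.under (𝓞 N) = I ∧ P ≠ P' := by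
    intro I
    by_cases h : ∃ v ∉ S ∪ hfin.toFinset, v.asIdeal = I
    · obtain ⟨v, hv, rfl⟩ := h
      obtain ⟨P, P', h⟩ := key v hv
      exact ⟨P, P', fun _ _ _ ↦ h⟩
    · push Not at h
      exact ⟨⊥, ⊥, fun v hv e ↦ (h v hv e).elim⟩
  choose p p' hpp using key'
  refine not_forall_exists_split (S ∪ hfin.toFinset) p p' ?_ ?_ ?_
  · intro v hv
    obtain ⟨h1, h2, h3, h4, h5⟩ := hpp v.asIdeal v hv rfl
    exact ⟨h1, h3, absNorm_eq_of_ne v.ne_bot h3 h4 h5⟩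
  · intro v hv
    obtain ⟨h1, h2, h3, h4, h5⟩ := hpp v.asIdeal v hv rfl
    exact ⟨h2, h4, absNorm_eq_of_ne v.ne_bot h4 h3 h5.symm⟩
  · intro v hv
    exact (hpp v.asIdeal v hv rfl).2.2.2.2

end QuadraticExtension

section Under

variable {N : Type*} [Field N] [NumberField N]

theorem finite_setOf_mem_asIdeal {x : 𝓞 N} (hx : x ≠ 0) :
    {v : HeightOneSpectrum (𝓞 N) | x ∈ v.asIdeal}.Finite := by
  refine (Ideal.finite_factors (I := Ideal.span {x}) (by simpa using hx)).subset ?_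
  intro v hv
  simpa [Ideal.dvd_span_singleton] using hv

variable (N) {L : Type*} [Field L] [NumberField L] [Algebra N L]

/-- The prime of the base below a given prime of an extension. -/
noncomputable def IsDedekindDomain.HeightOneSpectrum.below (w : HeightOneSpectrum (𝓞 L)) :
    HeightOneSpectrum (𝓞 N) where
  asIdeal := w.asIdeal.under (𝓞 N)
  isPrime := inferInstance
  ne_bot := Ideal.under_ne_bot _ w.ne_bot

instance (w : HeightOneSpectrum (𝓞 L)) : w.asIdeal.LiesOver (w.below N).asIdeal := ⟨rfl⟩

theorem finite_below_preimage {S : Set (HeightOneSpectrum (𝓞 N))} (hS : S.Finite) :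
    ((HeightOneSpectrum.below N : HeightOneSpectrum (𝓞 L) → _) ⁻¹' S).Finite := by
  refine hS.preimage' fun v _ ↦ ?_
  refine Set.Finite.of_finite_image (f := HeightOneSpectrum.asIdeal)
    ((IsDedekindDomain.primesOver_finite v.asIdeal (𝓞 L)).subset ?_)
    (fun _ _ _ _ ↦ HeightOneSpectrum.ext)
  rintro _ ⟨w, rfl, rfl⟩
  exact ⟨inferInstance, inferInstance⟩

theorem exists_below_eq (v : HeightOneSpectrum (𝓞 N)) :
    ∃ w : HeightOneSpectrum (𝓞 L), w.below N = v := by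
  obtain ⟨P, hP, hPv⟩ := Ideal.exists_maximal_ideal_liesOver_of_isIntegral (S := 𝓞 L) v.asIdeal
  refine ⟨⟨P, inferInstance, ?_⟩, HeightOneSpectrum.ext hPv.over.symm⟩
  rintro rfl
  exact v.ne_bot (by rw [hPv.over]; exact Ideal.under_bot _ _)

end Under

theorem isSquare_mul_of_not_isSquare {k : Type*} [Field k] [Finite k] {a b : k}
    (ha : ¬ IsSquare a) (hb : ¬ IsSquare b) : IsSquare (a * b) := by
  classical
  have := Fintype.ofFinite k
  have ha0 : a ≠ 0 := by rintro rfl; exact ha (IsSquare.zero)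
  have hb0 : b ≠ 0 := by rintro rfl; exact hb (IsSquare.zero)
  rw [← quadraticChar_one_iff_isSquare (mul_ne_zero ha0 hb0), map_mul,
    quadraticChar_neg_one_iff_not_isSquare.2 ha, quadraticChar_neg_one_iff_not_isSquare.2 hb]
  rfl

section Quadratic

variable {F K : Type*} [Field F] [NumberField F] [Field K] [NumberField K] [Algebra F K]
  [Algebra.IsQuadraticExtension F K] {δ : K}

theorem isSquare_or_of_isSquare_algebraMap {u d : F} (hd : ¬ IsSquare d)
    (hδ : δ ^ 2 = algebraMap F K d) (hu : IsSquare (algebraMap F K u)) :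
    IsSquare u ∨ IsSquare (u * d) := by
  obtain ⟨x, hx⟩ := hu
  obtain ⟨a, b, rfl⟩ := exists_eq_add_mul hd hδ x
  have h1 : algebraMap F K (u - a ^ 2 - b ^ 2 * d) = algebraMap F K (2 * a * b) * δ := by
    simp only [map_sub, map_mul, map_pow, ← hδ, hx, map_ofNat]
    ring
  have h2 : 2 * a * b = 0 := by
    by_contra h
    refine notMem_range_of_sq_eq hd hδ ((u - a ^ 2 - b ^ 2 * d) / (2 * a * b)) ?_
    rw [map_div₀, h1, mul_div_cancel_left₀]
    simpa using h
  rw [h2, map_zero, zero_mul, map_eq_zero_iff _ (algebraMap F K).injective] at h1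
  obtain h | rfl := mul_eq_zero.1 h2
  · obtain rfl : a = 0 := by simpa using h
    right
    exact ⟨b * d, by linear_combination d * h1⟩
  · left
    exact ⟨a, by linear_combination h1⟩

theorem exists_isSquare_mod_not_isSquare_mod (S : Finset (HeightOneSpectrum (𝓞 F)))
    {d u : 𝓞 F} (hd : ¬ IsSquare (d : F)) (hδ : δ ^ 2 = algebraMap F K d)
    (hu : ¬ IsSquare (u : F)) (hud : ¬ IsSquare (u * d : F)) :
    ∃ v ∉ S, (∃ e, e ^ 2 - d ∈ v.asIdeal) ∧ ∀ a, a ^ 2 - u ∉ v.asIdeal := by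
  have huK : ¬ IsSquare ((algebraMap (𝓞 F) (𝓞 K) u : 𝓞 K) : K) := fun h ↦
    (isSquare_or_of_isSquare_algebraMap (u := (u : F)) hd hδ h).elim hu hud
  obtain ⟨w, hwS, hw⟩ := exists_height_one_forall_sq_sub_notMem
    (finite_below_preimage F (L := K) S.finite_toSet).toFinset huK
  simp only [Set.Finite.mem_toFinset, Set.mem_preimage, Finset.mem_coe] at hwS
  have hu' (a : 𝓞 F) : a ^ 2 - u ∉ (w.below F).asIdeal := fun h ↦ hw (algebraMap _ _ a) (by
    have : algebraMap (𝓞 F) (𝓞 K) (a ^ 2 - u) ∈ w.asIdeal := h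
    simpa using this)
  refine ⟨w.below F, hwS, ?_, hu'⟩
  by_contra! hd'
  set v := w.below F
  let _ : Field (𝓞 F ⧸ v.asIdeal) := Ideal.Quotient.field _
  have : Finite (𝓞 F ⧸ v.asIdeal) := v.asIdeal.finiteQuotientOfFreeOfNeBot v.ne_bot
  have hns {x : 𝓞 F} (hx : ∀ a, a ^ 2 - x ∉ v.asIdeal) :
      ¬ IsSquare (Ideal.Quotient.mk v.asIdeal x) := by
    rintro ⟨y, hy⟩
    obtain ⟨y, rfl⟩ := Ideal.Quotient.mk_surjective y
    refine hx y ?_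
    rw [← Ideal.Quotient.eq, hy, map_pow, sq]
  obtain ⟨y, hy⟩ := isSquare_mul_of_not_isSquare (hns hu') (hns hd')
  obtain ⟨y, rfl⟩ := Ideal.Quotient.mk_surjective y
  have hint : IsIntegral ℤ δ := by
    refine IsIntegral.of_pow (n := 2) two_pos ?_
    rw [hδ]
    exact (RingOfIntegers.isIntegral_coe d).algebraMap
  let δ' : 𝓞 K := ⟨δ, hint⟩
  have hδ' : δ' ^ 2 = algebraMap (𝓞 F) (𝓞 K) d := RingOfIntegers.ext hδ
  have hδw : δ' ∉ w.asIdeal := fun h ↦ by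
    refine hd' 0 ?_
    have : algebraMap (𝓞 F) (𝓞 K) d ∈ w.asIdeal := by
      rw [← hδ', sq]; exact w.asIdeal.mul_mem_left _ h
    have : d ∈ v.asIdeal := this
    simpa using this
  have : IsSquare (Ideal.Quotient.mk w.asIdeal (algebraMap (𝓞 F) (𝓞 K) u)) := by
    let _ : Field (𝓞 K ⧸ w.asIdeal) := Ideal.Quotient.field _
    have h0 : Ideal.Quotient.mk w.asIdeal δ' ≠ 0 := by
      rwa [Ne, Ideal.Quotient.eq_zero_iff_mem]
    refine ⟨Ideal.Quotient.mk w.asIdeal (algebraMap (𝓞 F) (𝓞 K) y) /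
      Ideal.Quotient.mk w.asIdeal δ', ?_⟩
    rw [← map_mul, ← map_mul, Ideal.Quotient.eq] at hy
    have hy : algebraMap (𝓞 F) (𝓞 K) (u * d - y * y) ∈ w.asIdeal := hy
    rw [map_sub, ← Ideal.Quotient.eq, map_mul, ← hδ'] at hy
    field_simp
    simpa [sq] using hy
  obtain ⟨x, hx⟩ := this
  obtain ⟨x, rfl⟩ := Ideal.Quotient.mk_surjective x
  refine hw x ?_
  rw [← Ideal.Quotient.eq, hx, map_pow, sq]

end Quadratic

theorem relIndex_map_norm_mul_le {E : Type*} [Field E] [NeZero (2 : E)] (σ : Eˣ →* Eˣ)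
    (hσ : ∀ x, σ (σ x) = x) (hσ1 : σ (-1) = -1) (M P : Subgroup Eˣ) (hM : ∀ x ∈ M, σ x ∈ M)
    (hM1 : -1 ∈ M) [Module.Finite ℤ (Additive M)] (hP : ∀ x, x ∈ P ↔ x ∈ M ∧ σ x = x)
    (h90 : ∀ x ∈ M, x * σ x = 1 → ∃ y ∈ M, x = y / σ y) :
    (M.map (MonoidHom.id _ * σ)).relIndex P ≠ 0 ∧
    (M.map (MonoidHom.id _ * σ)).relIndex P * 2 ^ finrank ℤ (Additive M) ≤
      2 ^ (2 * finrank ℤ (Additive P)) := by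
  let τ : M →* M := (σ.comp M.subtype).codRestrict M fun x ↦ hM x x.2
  let Q : Subgroup Eˣ := M ⊓ (MonoidHom.id _ * σ).ker
  have hQ (x : Eˣ) : x ∈ Q ↔ x ∈ M ∧ x * σ x = 1 := Iff.rfl
  have hPM : P ≤ M := fun x hx ↦ ((hP x).1 hx).1
  have hQM : Q ≤ M := inf_le_left
  have h := relIndex_norm_mul_relIndex_squares τ (fun x ↦ Subtype.ext (hσ x))
    (P.subgroupOf M) (Q.subgroupOf M)
    (fun x ↦ by
      rw [Subgroup.mem_subgroupOf, hP, Subtype.ext_iff]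
      exact ⟨fun h ↦ h.2, fun h ↦ ⟨x.2, h⟩⟩)
    (fun x ↦ by
      rw [Subgroup.mem_subgroupOf, hQ, Subtype.ext_iff]
      exact ⟨fun h ↦ h.2, fun h ↦ ⟨x.2, h⟩⟩)
    (fun x hx ↦ by
      obtain ⟨y, hy, h⟩ := h90 x x.2 (Subgroup.mem_subgroupOf.1 hx).2
      exact ⟨⟨y, hy⟩, Subtype.ext h⟩)
  have hmap {H : Subgroup Eˣ} (hH : H ≤ M) : (H.subgroupOf M).map M.subtype = H :=
    Subgroup.map_subgroupOf_eq_of_le hH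
  have hsq {H : Subgroup Eˣ} (hH : H ≤ M) :
      (H.subgroupOf M).squares.map M.subtype = H.squares := by
    conv_rhs => rw [← hmap hH]
    rw [Subgroup.squares, Subgroup.squares, Subgroup.map_map, Subgroup.map_map]
    rfl
  have hinj := M.subtype_injective
  rw [← Subgroup.relIndex_map_map_of_injective _ _ hinj,
    ← Subgroup.relIndex_map_map_of_injective (Q.subgroupOf M).squares _ hinj,
    ← Subgroup.relIndex_map_map_of_injective (P.subgroupOf M).squares _ hinj,
    hmap hPM, hmap hQM, hsq hPM, hsq hQM] at h
  have hr : (MonoidHom.id M * τ).range.map M.subtype = M.map (MonoidHom.id _ * σ) := by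
    ext x
    constructor
    · rintro ⟨_, ⟨y, rfl⟩, rfl⟩
      exact ⟨y, y.2, rfl⟩
    · rintro ⟨y, hy, rfl⟩
      exact ⟨_, ⟨⟨y, hy⟩, rfl⟩, rfl⟩
  rw [hr] at h
  have fin {H : Subgroup Eˣ} (hH : H ≤ M) : Module.Finite ℤ (Additive H) :=
    Module.Finite.of_injective (MonoidHom.toAdditive (Subgroup.inclusion hH)).toIntLinearMap
      (Subgroup.inclusion_injective hH)
  have := fin hPM
  have := fin hQM
  have hP1 : -1 ∈ P := (hP _).2 ⟨hM1, hσ1⟩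
  have hQ1 : -1 ∈ Q := (hQ _).2 ⟨hM1, by rw [hσ1]; simp⟩
  rw [relIndex_squares_units Q hQ1, relIndex_squares_units P hP1] at h
  have hrk : finrank ℤ (Additive M) ≤ finrank ℤ (Additive P) + finrank ℤ (Additive Q) := by
    let f : Additive M →ₗ[ℤ] Additive P := (MonoidHom.toAdditive
      (((MonoidHom.id _ * σ).comp M.subtype).codRestrict P fun x ↦ (hP _).2 ⟨M.mul_mem x.2 (hM x x.2),
        by simp [hσ, mul_comm]⟩)).toIntLinearMap
    have hf (x : M) (hx : f (.ofMul x) = 0) : (x : Eˣ) ∈ Q :=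
      (hQ x).2 ⟨x.2, congr_arg (fun z : Additive P ↦ ((Additive.toMul z : P) : Eˣ)) hx⟩
    let g : LinearMap.ker f →ₗ[ℤ] Additive Q := AddMonoidHom.toIntLinearMap
      { toFun := fun x ↦ .ofMul ⟨(Additive.toMul x.1 : M), hf (Additive.toMul x.1) x.2⟩
        map_zero' := rfl
        map_add' := fun _ _ ↦ rfl }
    have hg : Function.Injective g := by
      intro x y hxy
      have := congr_arg (fun z : Additive Q ↦ ((Additive.toMul z : Q) : Eˣ)) hxy
      exact Subtype.ext (Additive.toMul.injective (Subtype.ext this))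
    have h1 := LinearMap.finrank_le_finrank_of_injective hg
    have h2 := Submodule.finrank_quotient_add_finrank (LinearMap.ker f)
    rw [f.quotKerEquivRange.finrank_eq] at h2
    have h3 := Submodule.finrank_le (LinearMap.range f)
    omega
  refine ⟨fun h0 ↦ ?_, ?_⟩
  · rw [h0, zero_mul] at h
    exact (pow_ne_zero _ two_ne_zero) h.symm
  · refine Nat.le_of_mul_le_mul_right (c := 2 ^ 1) ?_ (by norm_num)
    rw [← pow_add]
    calc _ ≤ (M.map (MonoidHom.id _ * σ)).relIndex P *
          2 ^ (finrank ℤ (Additive P) + finrank ℤ (Additive Q)) * 2 ^ 1 := by gcongr; norm_num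
      _ = ((M.map (MonoidHom.id _ * σ)).relIndex P * 2 ^ (finrank ℤ (Additive Q) + 1)) *
          2 ^ finrank ℤ (Additive P) := by ring
      _ = _ := by rw [h]; ring

section Galois

variable {N L : Type*} [Field N] [NumberField N] [Field L] [NumberField L] [Algebra N L]

theorem intValuation_comap_le (τ : 𝓞 L ≃ₐ[𝓞 N] 𝓞 L) {w w' : HeightOneSpectrum (𝓞 L)}
    (hw : w'.asIdeal = w.asIdeal.comap τ) (r : 𝓞 L) :
    w'.intValuation r ≤ w.intValuation (τ r) := by
  by_cases hr : r = 0
  · simp [hr]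
  have hr' : τ r ≠ 0 := by simpa using hr
  rw [w.intValuation_eq_exp_neg_multiplicity hr', HeightOneSpectrum.intValuation_le_pow_iff_mem, hw]
  have h := (w.intValuation_le_pow_iff_mem (τ r) _).1
    (w.intValuation_eq_exp_neg_multiplicity hr').le
  have : w.asIdeal.comap τ = w.asIdeal.map (τ.symm : 𝓞 L →+* 𝓞 L) := 
    (Ideal.map_comap_of_equiv (I := w.asIdeal) τ.symm.toRingEquiv).symm
  rw [this, ← Ideal.map_pow]
  have h2 := Ideal.mem_map_of_mem (τ.symm : 𝓞 L →+* 𝓞 L) h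
  simpa using h2

theorem exists_below_eq_and_valuation_eq [IsGalois N L] (σ : Gal(L/N)) (w : HeightOneSpectrum (𝓞 L)) :
    ∃ w' : HeightOneSpectrum (𝓞 L), w'.below N = w.below N ∧
      w'.asIdeal = w.asIdeal.comap (galRestrict (𝓞 N) N L (𝓞 L) σ) ∧
      ∀ x, w.valuation L (σ x) = w'.valuation L x := by
  set τ := galRestrict (𝓞 N) N L (𝓞 L) σ with hτ
  have hbot : w.asIdeal.comap τ ≠ ⊥ := by
    intro h
    apply w.ne_bot
    rw [← Ideal.map_comap_of_surjective τ τ.surjective w.asIdeal, h, Ideal.map_bot]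
  let w' : HeightOneSpectrum (𝓞 L) := ⟨w.asIdeal.comap τ, inferInstance, hbot⟩
  have hint (r : 𝓞 L) : w.intValuation (τ r) = w'.intValuation r := by
    refine le_antisymm ?_ (intValuation_comap_le τ rfl r)
    have := intValuation_comap_le τ.symm (w := w') (w' := w) ?_ (τ r)
    · simpa using this
    · ext x
      simp [w', Ideal.mem_comap]
  refine ⟨w', ?_, rfl, fun x ↦ ?_⟩
  · refine HeightOneSpectrum.ext ?_
    ext x
    change τ (algebraMap _ _ x) ∈ w.asIdeal ↔ algebraMap _ _ x ∈ w.asIdeal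
    rw [τ.commutes]
  · obtain ⟨a, b, hb, rfl⟩ := IsFractionRing.div_surjective (A := 𝓞 L) x
    have hc (r : 𝓞 L) : σ (algebraMap (𝓞 L) L r) = algebraMap (𝓞 L) L (τ r) :=
      (algebraMap_galRestrict_apply (𝓞 N) σ r).symm
    simp only [map_div₀, hc, HeightOneSpectrum.valuation_of_algebraMap, hint]

theorem exists_pos_valuation_algebraMap (w : HeightOneSpectrum (𝓞 L)) :
    ∃ e ≠ 0, ∀ x : N, w.valuation L (algebraMap N L x) = ((w.below N).valuation N x) ^ e := by
  refine ⟨_, ?_, fun x ↦ (HeightOneSpectrum.valuation_liesOver L (w.below N) w x).symm⟩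
  exact Ideal.IsDedekindDomain.ramificationIdx'_ne_zero_of_liesOver w.asIdeal (w.below N).ne_bot

end Galois

section Ord

variable {N : Type*} [Field N] [NumberField N]

theorem finite_setOf_ord_ne_zero (x : Nˣ) :
    {v : HeightOneSpectrum (𝓞 N) | v.ord N (.ofMul x) ≠ 0}.Finite := by
  obtain ⟨a, b, hb, hx⟩ := IsFractionRing.div_surjective (A := 𝓞 N) (x : N)
  have hb0 : b ≠ 0 := nonZeroDivisors.ne_zero hb
  have ha0 : a ≠ 0 := by
    rintro rfl
    simp at hx
    exact x.ne_zero hx.symm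
  refine ((finite_setOf_mem_asIdeal ha0).union (finite_setOf_mem_asIdeal hb0)).subset ?_
  intro v hv
  by_contra h
  simp only [Set.mem_union, Set.mem_ofPred_eq, not_or] at h
  refine hv ((v.valuation_eq_one_iff_ord x).1 ?_)
  rw [← hx, map_div₀, (v.valuation_eq_one_iff_notMem (K := N)).2 h.1,
    (v.valuation_eq_one_iff_notMem (K := N)).2 h.2, div_one]

theorem finite_setOf_valuation_ne (x : N) : {v : HeightOneSpectrum (𝓞 N) | 
    v.valuation N x ≠ 0 ∧ v.valuation N x ≠ 1}.Finite := by
  by_cases hx : x = 0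
  · simp [hx]
  · refine (finite_setOf_ord_ne_zero (Units.mk0 x hx)).subset ?_
    rintro v ⟨-, hv⟩
    exact fun h ↦ hv ((v.valuation_eq_one_iff_ord (Units.mk0 x hx)).2 h)

/-- The primes outside `S` have independent uniformizers, i.e. the `S`-class group is trivial. -/
def HasUniformizers (S : Set (HeightOneSpectrum (𝓞 N))) : Prop :=
  ∀ v ∉ S, ∃ z : Nˣ, v.ord N (.ofMul z) = 1 ∧ ∀ w ∉ S, w ≠ v → w.ord N (.ofMul z) = 0

theorem HasUniformizers.mono {S T : Set (HeightOneSpectrum (𝓞 N))} (hS : HasUniformizers S)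
    (hST : S ⊆ T) : HasUniformizers T := fun v hv ↦
  (hS v (fun h ↦ hv (hST h))).imp fun _ hz ↦ ⟨hz.1, fun w hw ↦ hz.2 w fun h ↦ hw (hST h)⟩

theorem HasUniformizers.exists_forall_ord_eq {S : Set (HeightOneSpectrum (𝓞 N))}
    (hS : HasUniformizers S) (n : HeightOneSpectrum (𝓞 N) → ℤ) (hn : {v | n v ≠ 0}.Finite) :
    ∃ z : Nˣ, ∀ v ∉ S, v.ord N (.ofMul z) = n v := by
  classical
  have (v : HeightOneSpectrum (𝓞 N)) : ∃ z : Nˣ, v ∉ S → v.ord N (.ofMul z) = 1 ∧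
      ∀ w ∉ S, w ≠ v → w.ord N (.ofMul z) = 0 := by
    by_cases hv : v ∈ S
    · exact ⟨1, fun h ↦ (h hv).elim⟩
    · exact (hS v hv).imp fun _ h _ ↦ h
  choose z hz using this
  have key (A : Finset (HeightOneSpectrum (𝓞 N))) (hA : ∀ a ∈ A, a ∉ S) (v) (hv : v ∉ S) :
      v.ord N (.ofMul (∏ a ∈ A, z a ^ n a)) = if v ∈ A then n v else 0 := by
    rw [ofMul_prod, map_sum, ← Finset.sum_ite_eq A v n]
    refine Finset.sum_congr rfl fun a ha ↦ ?_
    rw [ofMul_zpow, map_zsmul]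
    split_ifs with h
    · subst h; rw [(hz v hv).1]; simp
    · rw [(hz a (hA a ha)).2 v hv h]; simp
  refine ⟨∏ a ∈ hn.toFinset with a ∉ S, z a ^ n a, fun v hv ↦ ?_⟩
  rw [key _ (by simp) v hv]
  by_cases h : n v = 0 <;> simp [h, hv]

end Ord

section Quadratic

variable {N L : Type*} [Field N] [NumberField N] [Field L] [NumberField L] [Algebra N L]
  [Algebra.IsQuadraticExtension N L] {θ : L} {c : Nˣ} {σ : Gal(L/N)}

theorem exists_forall_valuation_eq (hc : ¬ IsSquare (c : N)) (hθ : θ ^ 2 = algebraMap N L c)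
    (hσ : σ θ = -θ) {S : Set (HeightOneSpectrum (𝓞 N))} (h2 : ∀ v ∉ S, (2 : 𝓞 N) ∉ v.asIdeal)
    (hS : HasUniformizers S) (hcS : ∀ v ∉ S, Even (v.ord N (.ofMul c))) {y : L} (hy0 : y ≠ 0)
    (hy : ∀ w : HeightOneSpectrum (𝓞 L), w.below N ∉ S → w.valuation L (σ y) = w.valuation L y) :
    ∃ z : Nˣ, ∀ w : HeightOneSpectrum (𝓞 L), w.below N ∉ S →
      w.valuation L (algebraMap N L z) = w.valuation L y := by
  classical
  obtain ⟨α, β, hαβ⟩ := exists_eq_add_mul hc hθ y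
  have hσy : σ y = algebraMap N L α - algebraMap N L β * θ := by
    rw [hαβ, algEquiv_apply_add_mul hσ]
  have hsq (v : HeightOneSpectrum (𝓞 N)) (f : N) :
      v.valuation N (f ^ 2) = 0 ∨ ∃ k : ℤ, v.valuation N (f ^ 2) = WithZero.exp (-k) ^ 2 := by
    by_cases hf : f = 0
    · simp [hf]
    · right
      refine ⟨v.ord N (.ofMul (Units.mk0 f hf)), ?_⟩
      rw [← v.valuation_eq_exp_ord, map_pow, Units.val_mk0]
  have hmax (v : HeightOneSpectrum (𝓞 N)) : ∃ n : ℤ, if v ∈ S then n = 0 else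
      max (v.valuation N (α ^ 2)) (v.valuation N (β ^ 2 * c)) = WithZero.exp (-n) ^ 2 := by
    by_cases hv : v ∈ S
    · simp [hv]
    · simp only [hv, if_false]
      have h1 := hsq v α
      have h3 : v.valuation N (β ^ 2 * c) = 0 ∨
          ∃ k : ℤ, v.valuation N (β ^ 2 * c) = WithZero.exp (-k) ^ 2 := by
        obtain ⟨m, hm⟩ := hcS v hv
        obtain h | ⟨k, h⟩ := hsq v β
        · left; rw [map_mul, h, zero_mul]
        · right
          refine ⟨k + m, ?_⟩
          rw [map_mul, h, v.valuation_eq_exp_ord, hm, ← WithZero.exp_nsmul, ← WithZero.exp_nsmul,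
            ← WithZero.exp_add]
          congr 1
          simp only [nsmul_eq_mul]
          push_cast
          ring
      have h0 : v.valuation N (α ^ 2) ≠ 0 ∨ v.valuation N (β ^ 2 * c) ≠ 0 := by
        by_contra! h
        simp only [map_eq_zero, mul_eq_zero, c.ne_zero, or_false, pow_eq_zero_iff, ne_eq,
          OfNat.ofNat_ne_zero, not_false_eq_true] at h
        exact hy0 (by rw [hαβ, h.1, h.2]; simp)
      obtain h1 | ⟨k, h1⟩ := h1
      · rw [h1, max_eq_right (by simp)]
        exact h3.resolve_left (h0.resolve_left fun h ↦ h h1)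
      obtain h3 | ⟨l, h3⟩ := h3
      · rw [h3, max_eq_left (by simp)]
        exact ⟨k, h1⟩
      obtain h | h := max_choice (v.valuation N (α ^ 2)) (v.valuation N (β ^ 2 * c))
      · exact ⟨k, by rw [h, h1]⟩
      · exact ⟨l, by rw [h, h3]⟩
  choose n hn using hmax
  have hfin : {v | n v ≠ 0}.Finite := by
    refine ((finite_setOf_valuation_ne (α ^ 2)).union
      (finite_setOf_valuation_ne (β ^ 2 * c))).subset fun v hv ↦ ?_
    by_contra h
    have hv' := hn v
    simp only [Set.mem_union, Set.mem_ofPred_eq, not_or, not_and, not_not] at h hv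
    have h0 : WithZero.exp (-n v) ^ 2 ≠ (0 : WithZero (Multiplicative ℤ)) :=
      pow_ne_zero _ WithZero.exp_ne_zero
    have h1 : WithZero.exp (-n v) ^ 2 ≠ (1 : WithZero (Multiplicative ℤ)) := by
      rw [← WithZero.exp_nsmul, ← WithZero.exp_zero, Ne, WithZero.exp_inj]
      simpa using hv
    split_ifs at hv' with hvS
    · exact hv hv'
    · rw [← hv'] at h0 h1
      obtain h3 | h3 := max_choice (v.valuation N (α ^ 2)) (v.valuation N (β ^ 2 * c))
      · rw [h3] at h0 h1
        exact h1 (h.1 h0)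
      · rw [h3] at h0 h1
        exact h1 (h.2 h0)
  obtain ⟨z, hz⟩ := hS.exists_forall_ord_eq n hfin
  refine ⟨z, fun w hw ↦ ?_⟩
  obtain ⟨e, he, hwe⟩ := exists_pos_valuation_algebraMap (N := N) w
  have hvz : (w.below N).valuation N z ^ 2 =
      max ((w.below N).valuation N (α ^ 2)) ((w.below N).valuation N (β ^ 2 * c)) := by
    have := hn (w.below N)
    rw [if_neg hw] at this
    rw [this, HeightOneSpectrum.valuation_eq_exp_ord, hz _ hw]
  have hwz : w.valuation L (algebraMap N L z) ^ 2 =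
      max (w.valuation L (algebraMap N L α) ^ 2) (w.valuation L (algebraMap N L β * θ) ^ 2) := by
    rw [← map_pow, ← map_pow, ← map_pow, ← map_pow, ← map_pow, mul_pow, hθ, ← map_pow, ← map_mul,
      hwe, hwe, hwe, map_pow, hvz]
    exact (pow_left_mono e).map_max
  have hw2 : w.valuation L 2 = 1 := by
    have := hwe 2
    have h2' := ((w.below N).valuation_eq_one_iff_notMem (K := N)).2 (h2 _ hw)
    rw [map_ofNat] at h2'
    rwa [h2', one_pow, map_ofNat] at this
  have h1 : w.valuation L (algebraMap N L α) ≤ w.valuation L y := by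
    have := (w.valuation L).map_add y (σ y)
    rw [hy w hw, max_self] at this
    refine le_trans (le_of_eq ?_) this
    rw [hσy, hαβ, ← one_mul (w.valuation L (algebraMap N L α)), ← hw2, ← map_mul]
    congr 1
    ring
  have h3 : w.valuation L (algebraMap N L β * θ) ≤ w.valuation L y := by
    have := (w.valuation L).map_sub y (σ y)
    rw [hy w hw, max_self] at this
    refine le_trans (le_of_eq ?_) this
    rw [hσy, hαβ, ← one_mul (w.valuation L (algebraMap N L β * θ)), ← hw2, ← map_mul]
    congr 1
    ring
  have h4 : w.valuation L y = max (w.valuation L (algebraMap N L α))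
      (w.valuation L (algebraMap N L β * θ)) :=
    le_antisymm (hαβ ▸ (w.valuation L).map_add _ _) (max_le h1 h3)
  rw [← (pow_left_mono 2).map_max, ← h4] at hwz
  exact (pow_left_inj₀ zero_le zero_le two_ne_zero).1 hwz

end Quadratic

section Quadratic

variable {N L : Type*} [Field N] [NumberField N] [Field L] [NumberField L] [Algebra N L]
  [Algebra.IsQuadraticExtension N L] {θ : L} {σ : Gal(L/N)}

theorem isUnramifiedIn_of_pos (hN : ∀ v : InfinitePlace N, v.IsReal) {c : N}
    (hc : ¬ IsSquare c) (hθ : θ ^ 2 = algebraMap N L c) {v : InfinitePlace N}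
    (hv : 0 < InfinitePlace.embedding_of_isReal (hN v) c) : v.IsUnramifiedIn L := by
  rintro w hw
  by_contra h
  have hcomp := InfinitePlace.IsRamified.comap_embedding h
  rw [hw] at hcomp
  have hreal (x : N) : star (w.embedding (algebraMap N L x)) = w.embedding (algebraMap N L x) := by
    rw [← RingHom.comp_apply, ← hcomp, ← InfinitePlace.embedding_of_isReal_apply (hN v)]
    exact Complex.conj_ofReal _
  have hθr : star (w.embedding θ) = w.embedding θ := by
    have h1 : w.embedding θ ^ 2 = (Real.sqrt (InfinitePlace.embedding_of_isReal (hN v) c) : ℂ) ^ 2 := by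
      rw [← map_pow, hθ, ← RingHom.comp_apply, ← hcomp,
        ← InfinitePlace.embedding_of_isReal_apply (hN v), ← Complex.ofReal_pow, Real.sq_sqrt hv.le]
    obtain h | h := sq_eq_sq_iff_eq_or_eq_neg.1 h1
    · rw [h]; exact Complex.conj_ofReal _
    · rw [h, star_neg]; congr 1; exact Complex.conj_ofReal _
  refine InfinitePlace.isComplex_iff.1 (InfinitePlace.IsRamified.isComplex h) (RingHom.ext fun x ↦ ?_)
  obtain ⟨α, β, rfl⟩ := exists_eq_add_mul hc hθ x
  change star (w.embedding (algebraMap N L α + algebraMap N L β * θ)) =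
    w.embedding (algebraMap N L α + algebraMap N L β * θ)
  rw [map_add, map_mul, star_add, star_mul', hreal, hreal, hθr]

theorem two_mul_card_le_card_infinitePlace_add (hN : ∀ v : InfinitePlace N, v.IsReal) {c : N}
    (hc : ¬ IsSquare c) (hθ : θ ^ 2 = algebraMap N L c) (P : Finset (InfinitePlace N))
    (hP : ∀ v ∉ P, 0 < InfinitePlace.embedding_of_isReal (hN v) c) :
    2 * Fintype.card (InfinitePlace N) ≤ Fintype.card (InfinitePlace L) + P.card := by
  classical
  rw [InfinitePlace.card_eq_card_isUnramifiedIn (k := N) (K := L),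
    Algebra.IsQuadraticExtension.finrank_eq_two]
  have h1 := Finset.card_add_card_compl ({v : InfinitePlace N | v.IsUnramifiedIn L} : Finset _)
  have h2 : ({v : InfinitePlace N | v.IsUnramifiedIn L} : Finset _)ᶜ ⊆ P := by
    intro v hv
    by_contra h
    simp only [Finset.compl_filter, Finset.mem_filter, Finset.mem_univ, true_and] at hv
    exact hv (isUnramifiedIn_of_pos hN hc hθ (hP v h))
  have h3 := Finset.card_le_card h2
  omega

theorem exists_two_primes_above {c : 𝓞 N} (hc : ¬ IsSquare (c : N))
    (hθ : θ ^ 2 = algebraMap N L c) {v : HeightOneSpectrum (𝓞 N)} {y z : 𝓞 N}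
    (hy : y ∉ v.asIdeal) (hz : z ∈ v.asIdeal) (hyz : y ^ 2 - c = 4 * z) :
    ∃ w w' : HeightOneSpectrum (𝓞 L), w ≠ w' ∧ w.below N = v ∧ w'.below N = v := by
  obtain ⟨σ, hσ⟩ := exists_algEquiv_apply_eq_neg hc hθ
  have hyz' : (algebraMap N L y) ^ 2 - θ ^ 2 = 4 * algebraMap N L z := by
    rw [hθ]
    have := congr_arg (algebraMap N L) (congr_arg (algebraMap (𝓞 N) N) hyz)
    simpa [map_ofNat] using this
  have hint : IsIntegral ℤ ((algebraMap N L y + θ) / 2) := by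
    have : IsIntegral (𝓞 N) ((algebraMap N L y + θ) / 2) := by
      refine ⟨.X ^ 2 - .C y * .X + .C z, by monicity!, ?_⟩
      simp only [Polynomial.eval₂_add, Polynomial.eval₂_sub, Polynomial.eval₂_mul,
        Polynomial.eval₂_pow, Polynomial.eval₂_C, Polynomial.eval₂_X]
      rw [IsScalarTower.algebraMap_apply (𝓞 N) N L, IsScalarTower.algebraMap_apply (𝓞 N) N L]
      linear_combination (-1 / 4) * hyz'
    exact isIntegral_trans _ this
  let ϑ : 𝓞 L := ⟨_, hint⟩
  have hprod : ϑ * (algebraMap (𝓞 N) (𝓞 L) y - ϑ) = algebraMap (𝓞 N) (𝓞 L) z := by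
    apply RingOfIntegers.ext
    change (algebraMap N L y + θ) / 2 * (algebraMap N L y - (algebraMap N L y + θ) / 2) =
      algebraMap N L z
    linear_combination (1 / 4) * hyz'
  have hτ : galRestrict (𝓞 N) N L (𝓞 L) σ ϑ = algebraMap (𝓞 N) (𝓞 L) y - ϑ := by
    apply RingOfIntegers.ext
    refine (algebraMap_galRestrict_apply (𝓞 N) σ ϑ).trans ?_
    change σ ((algebraMap N L y + θ) / 2) = algebraMap N L y - (algebraMap N L y + θ) / 2
    rw [map_div₀, map_add, hσ, σ.commutes, map_ofNat]
    ring
  obtain ⟨w, rfl⟩ := exists_below_eq N (L := L) v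
  obtain ⟨w', hw', hww', -⟩ := exists_below_eq_and_valuation_eq σ w
  refine ⟨w, w', ?_, rfl, hw'⟩
  rintro rfl
  have hm (x) (hx : x ∈ w.asIdeal) : galRestrict (𝓞 N) N L (𝓞 L) σ x ∈ w.asIdeal := by
    rw [hww'] at hx; exact hx
  have hzw : algebraMap (𝓞 N) (𝓞 L) z ∈ w.asIdeal := hz
  have hyw : algebraMap (𝓞 N) (𝓞 L) y ∉ w.asIdeal := hy
  rw [← hprod] at hzw
  obtain h | h := w.isPrime.mem_or_mem hzw
  · have h2 := w.asIdeal.add_mem h (hm _ h)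
    rw [hτ] at h2
    exact hyw (by simpa using h2)
  · have h2 := w.asIdeal.add_mem h (hm _ h)
    rw [map_sub, hτ, AlgEquiv.commutes] at h2
    exact hyw (by simpa using h2)

theorem card_add_card_le_card_below_preimage [DecidableEq (HeightOneSpectrum (𝓞 N))]
    (S T : Finset (HeightOneSpectrum (𝓞 N)))
    (hST : Disjoint S T) (hS : ∀ v ∈ S, ∃ w w' : HeightOneSpectrum (𝓞 L), w ≠ w' ∧
      w.below N = v ∧ w'.below N = v) :
    2 * S.card + T.card ≤ Nat.card ((HeightOneSpectrum.below N : HeightOneSpectrum (𝓞 L) → _) ⁻¹'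
      (S ∪ T : Finset _)) := by
  classical
  have hfin := finite_below_preimage N (L := L) (S ∪ T).finite_toSet
  have h := Finset.card_eq_sum_card_fiberwise (s := hfin.toFinset) (t := S ∪ T)
    (f := HeightOneSpectrum.below N) (fun w hw ↦ hfin.mem_toFinset.1 hw)
  rw [Nat.card_coe_set_eq, Set.ncard_eq_toFinset_card _ hfin, h, Finset.sum_union hST, mul_comm,
    Finset.card_eq_sum_ones T, ← smul_eq_mul]
  refine add_le_add (Finset.card_nsmul_le_sum _ _ _ fun v hv ↦ ?_)
    (Finset.sum_le_sum fun v hv ↦ ?_)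
  · obtain ⟨w, w', hne, hw, hw'⟩ := hS v hv
    rw [← Finset.card_pair hne]
    refine Finset.card_le_card ?_
    intro x hx
    simp only [Finset.mem_insert, Finset.mem_singleton] at hx
    obtain rfl | rfl := hx <;> simp [*]
  · obtain ⟨w, hw⟩ := exists_below_eq N (L := L) v
    exact Finset.card_pos.2 ⟨w, by simp [*]⟩

end Quadratic

/-- The group of nonzero values of the form `a ^ 2 - c * b ^ 2`. -/
def normFormSubgroup {E : Type*} [Field E] (c : E) : Subgroup Eˣ where
  carrier := {x | ∃ a b : E, (x : E) = a ^ 2 - c * b ^ 2}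
  one_mem' := ⟨1, 0, by simp⟩
  mul_mem' := by
    rintro x y ⟨a, b, hx⟩ ⟨a', b', hy⟩
    exact ⟨a * a' + c * b * b', a * b' + a' * b, by rw [Units.val_mul, hx, hy]; ring⟩
  inv_mem' := by
    rintro x ⟨a, b, hx⟩
    refine ⟨a / x, b / x, ?_⟩
    have := x.ne_zero
    rw [Units.val_inv_eq_inv_val]
    field_simp
    exact hx

section Quadratic

variable {N : Type*} [Field N] [NumberField N] 

theorem two_mul_relIndex_normFormSubgroup_le (hN : ∀ v : InfinitePlace N, v.IsReal)
    {c : Nˣ} {c' : 𝓞 N} (hc : ¬ IsSquare (c : N)) (hc' : (c' : N) = c)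
    (S T : Finset (HeightOneSpectrum (𝓞 N))) (hST : Disjoint S T)
    (h2 : ∀ v ∉ S, (2 : 𝓞 N) ∉ v.asIdeal) (hS : HasUniformizers (S : Set (HeightOneSpectrum (𝓞 N))))
    (hcS : ∀ v ∉ S, v ∉ T → Even (v.ord N (.ofMul c)))
    {y z : 𝓞 N} (hy : ∀ v ∈ S, y ∉ v.asIdeal) (hz : ∀ v ∈ S, z ∈ v.asIdeal)
    (hyz : y ^ 2 - c' = 4 * z) (P : Finset (InfinitePlace N))
    (hP : ∀ v ∉ P, 0 < InfinitePlace.embedding_of_isReal (hN v) c) :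
    (normFormSubgroup (c : N)).relIndex ((S : Set (HeightOneSpectrum (𝓞 N))).unit N) ≠ 0 ∧
    2 * (normFormSubgroup (c : N)).relIndex ((S : Set (HeightOneSpectrum (𝓞 N))).unit N) ≤
      2 ^ (T.card + P.card) := by
  classical
  obtain ⟨L, _, _, _, θ, _, hθ⟩ := exists_quadratic_extension N hc
  obtain ⟨σ, hσ⟩ := exists_algEquiv_apply_eq_neg hc hθ
  have hσ2 (x : L) : σ (σ x) = x := by
    obtain ⟨a, b, rfl⟩ := exists_eq_add_mul hc hθ x
    simp [hσ]
  have h2L : (2 : L) ≠ 0 := two_ne_zero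
  set A : Set (HeightOneSpectrum (𝓞 N)) := ↑(S ∪ T) with hA
  have hSA : (S : Set (HeightOneSpectrum (𝓞 N))) ⊆ A := by simp [hA]
  have : Finite A := by rw [hA]; exact Finset.finite_toSet _
  let B : Set (HeightOneSpectrum (𝓞 L)) := HeightOneSpectrum.below N ⁻¹' A
  have : Finite B := finite_below_preimage N (L := L) (Finset.finite_toSet _)
  have hMmem (x : Lˣ) : x ∈ B.unit L ↔ ∀ w : HeightOneSpectrum (𝓞 L), w.below N ∉ A → w.valuation L x = 1 := Iff.rfl
  let τ : Lˣ →* Lˣ := Units.map (σ : L →* L)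
  let ι : Nˣ →* Lˣ := Units.map (algebraMap N L : N →* L)
  have hι : Function.Injective ι := Units.map_injective (algebraMap N L).injective
  have hτM (x) (hx : x ∈ B.unit L) : τ x ∈ B.unit L := by
    rw [hMmem] at hx ⊢
    intro w hw
    obtain ⟨w', hw', -, hv⟩ := exists_below_eq_and_valuation_eq σ w
    have := hx w' (by rwa [hw'])
    rwa [← hv] at this
  have hιM (x) : ι x ∈ B.unit L ↔ x ∈ A.unit N := by
    constructor
    · intro h v hv
      obtain ⟨w, rfl⟩ := exists_below_eq N (L := L) v
      have h1 : w.valuation L (algebraMap N L x) = 1 := h w hv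
      obtain ⟨e, he, hwe⟩ := exists_pos_valuation_algebraMap (N := N) w
      rw [hwe] at h1
      exact (pow_left_inj₀ zero_le zero_le he).1 (h1.trans (one_pow e).symm)
    · intro h w hw
      obtain ⟨e, he, hwe⟩ := exists_pos_valuation_algebraMap (N := N) w
      change w.valuation L (algebraMap N L x) = 1
      have h1 : (w.below N).valuation N x = 1 := h _ hw
      rw [hwe, h1, one_pow]
  have hcA : ∀ v ∉ A, Even (v.ord N (.ofMul c)) := fun v hv ↦ by
    simp only [hA, Finset.coe_union, Set.mem_union, not_or] at hv
    exact hcS v hv.1 hv.2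
  have hfix (x : Lˣ) : x ∈ (A.unit N).map ι ↔ x ∈ B.unit L ∧ τ x = x := by
    constructor
    · rintro ⟨x, hx, rfl⟩
      exact ⟨(hιM x).2 hx, Units.ext (σ.commutes _)⟩
    · rintro ⟨hx, hτx⟩
      obtain ⟨a, b, hab⟩ := exists_eq_add_mul hc hθ (x : L)
      have h1 : σ x = x := congr_arg Units.val hτx
      rw [hab, algEquiv_apply_add_mul hσ] at h1
      have h3 : algebraMap N L b * θ = 0 := by
        have : (2 : L) * (algebraMap N L b * θ) = 0 := by linear_combination -h1
        exact (mul_eq_zero.1 this).resolve_left h2L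
      rw [h3, add_zero] at hab
      have ha : a ≠ 0 := by
        rintro rfl
        rw [map_zero] at hab
        exact x.ne_zero hab
      have hx' : ι (Units.mk0 a ha) = x := Units.ext hab.symm
      exact ⟨Units.mk0 a ha, (hιM _).1 (hx' ▸ hx), hx'⟩
  have hneg : (-1 : Lˣ) ∈ B.unit L := by
    rw [hMmem]
    intro w _
    rw [Units.val_neg, Valuation.map_neg, Units.val_one, map_one]
  have h90 : ∀ x ∈ B.unit L, x * τ x = 1 → ∃ y ∈ B.unit L, x = y / τ y := by
    intro x hx hx1
    have key : ∃ y : Lˣ, x = y / τ y := by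
      by_cases hx0 : x = -1
      · have hθ0 : θ ≠ 0 := by
          rintro rfl
          exact notMem_range_of_sq_eq hc hθ 0 (map_zero _)
        refine ⟨Units.mk0 θ hθ0, ?_⟩
        rw [hx0, eq_div_iff_mul_eq']
        ext
        simp [τ, hσ]
      · have h0 : (1 + x : L) ≠ 0 := by
          intro h
          exact hx0 (Units.ext (by rw [Units.val_neg, Units.val_one]; linear_combination h))
        refine ⟨Units.mk0 _ h0, ?_⟩
        rw [eq_div_iff_mul_eq']
        ext
        have h1 : (x : L) * σ x = 1 := congr_arg Units.val hx1
        change (x : L) * σ (1 + x) = 1 + x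
        rw [map_add, map_one]
        linear_combination h1
    obtain ⟨u, hu⟩ := key
    have hu' : u = x * τ u := by rw [hu, div_mul_cancel]
    obtain ⟨t, ht⟩ := exists_forall_valuation_eq hc hθ hσ (S := A) (fun v hv ↦ h2 v fun h ↦ hv (hSA h))
      (hS.mono hSA) hcA u.ne_zero (fun w hw ↦ by
        have h1 : w.valuation L x = 1 := (hMmem x).1 hx w hw
        have h3 : (u : L) = x * σ u := congr_arg Units.val hu'
        conv_rhs => rw [h3]
        rw [map_mul, h1, one_mul])
    have hτι : τ (ι t) = ι t := Units.ext (σ.commutes _)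
    refine ⟨u / ι t, ?_, ?_⟩
    · rw [hMmem]
      intro w hw
      rw [Units.val_div_eq_div_val, map_div₀, ← ht w hw]
      exact div_self (by simp)
    · rw [map_div, hτι, div_div_div_cancel_right, hu]
  obtain ⟨hne, hle⟩ := relIndex_map_norm_mul_le τ (fun x ↦ Units.ext (hσ2 x))
    (Units.ext (by simp [τ])) (B.unit L) ((A.unit N).map ι) hτM hneg hfix h90
  have hle' : (B.unit L).map (MonoidHom.id _ * τ) ≤ (normFormSubgroup (c : N)).map ι := by
    rintro _ ⟨x, hx, rfl⟩
    obtain ⟨a, b, hab⟩ := exists_eq_add_mul hc hθ (x : L)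
    have h1 : algebraMap N L (a ^ 2 - c * b ^ 2) = x * σ x := by
      rw [hab, algEquiv_apply_add_mul hσ, map_sub, map_mul, ← hθ, map_pow, map_pow]
      ring
    have h0 : a ^ 2 - c * b ^ 2 ≠ 0 := by
      intro h
      rw [h, map_zero] at h1
      have := (x * τ x).ne_zero
      exact this h1.symm
    exact ⟨Units.mk0 _ h0, ⟨a, b, rfl⟩, Units.ext h1⟩
  have hSAu : (S : Set (HeightOneSpectrum (𝓞 N))).unit N ≤ A.unit N :=
    fun x hx v hv ↦ hx v fun h ↦ hv (hSA h)
  have h3 := Subgroup.relIndex_le_of_le_left hle' hne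
  have hne3 := fun h ↦ hne (Subgroup.relIndex_eq_zero_of_le_left hle' h)
  rw [Subgroup.relIndex_map_map_of_injective _ _ hι] at h3 hne3
  have h4 := Subgroup.relIndex_le_of_le_right hSAu hne3
  refine ⟨fun h ↦ hne3 (Subgroup.relIndex_eq_zero_of_le_right hSAu h), ?_⟩
  have hrP : finrank ℤ (Additive ((A.unit N).map ι)) = finrank ℤ (Additive (A.unit N)) :=
    ((MulEquiv.toAdditive ((A.unit N).equivMapOfInjective ι hι)).toIntLinearEquiv.finrank_eq).symm
  rw [hrP, finrank_sUnit, finrank_sUnit, Units.rank, Units.rank] at hle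
  have hcard : 2 * S.card + T.card ≤ Nat.card B :=
    card_add_card_le_card_below_preimage S T hST fun v hv ↦
      exists_two_primes_above (by rwa [hc']) (by rwa [hc']) (hy v hv) (hz v hv) hyz
  have hcardA : Nat.card A = S.card + T.card := by
    rw [hA, Nat.card_coe_set_eq, Set.ncard_coe_finset, Finset.card_union_of_disjoint hST]
  have hinf := two_mul_card_le_card_infinitePlace_add hN hc hθ P hP
  have hN0 : 0 < Fintype.card (InfinitePlace N) := Fintype.card_pos
  have hL0 : 0 < Fintype.card (InfinitePlace L) := Fintype.card_pos
  set R := (normFormSubgroup (c : N)).relIndex ((S : Set (HeightOneSpectrum (𝓞 N))).unit N)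
  set m := Fintype.card (InfinitePlace L) - 1 + Nat.card B with hm
  set k := 2 * (Fintype.card (InfinitePlace N) - 1 + Nat.card A) with hk
  have hkm : k + 1 ≤ m + (T.card + P.card) := by omega
  refine Nat.le_of_mul_le_mul_right (c := 2 ^ m) ?_ (by positivity)
  calc 2 * R * 2 ^ m = 2 * (R * 2 ^ m) := by ring
    _ ≤ 2 * 2 ^ k := by gcongr; exact (Nat.mul_le_mul_right _ (h4.trans h3)).trans hle
    _ = 2 ^ (k + 1) := by ring
    _ ≤ 2 ^ (m + (T.card + P.card)) := Nat.pow_le_pow_right two_pos hkm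
    _ = _ := by ring

end Quadratic

section LocalSquares

variable {N : Type*} [Field N] [NumberField N]

theorem valuation_eq_one_of_sub_sq_lt {v : HeightOneSpectrum (𝓞 N)} {x a : N}
    (ha : v.valuation N a = 1) (hx : v.valuation N (x - a ^ 2) < 1) : v.valuation N x = 1 := by
  have := Valuation.map_add_eq_of_lt_right (v.valuation N) (x := x - a ^ 2) (y := a ^ 2)
    (by rwa [map_pow, ha, one_pow])
  rwa [sub_add_cancel, map_pow, ha, one_pow] at this

/-- The group of units at `v` which are squares modulo `v`. -/
def localSquares (v : HeightOneSpectrum (𝓞 N)) : Subgroup Nˣ where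
  carrier := {u | ∃ a : N, v.valuation N a = 1 ∧ v.valuation N (u - a ^ 2) < 1}
  one_mem' := ⟨1, by simp⟩
  mul_mem' := by
    rintro x y ⟨a, ha, hx⟩ ⟨b, hb, hy⟩
    refine ⟨a * b, by rw [map_mul, ha, hb, one_mul], ?_⟩
    have h1 := valuation_eq_one_of_sub_sq_lt ha hx
    have : ((x * y : Nˣ) : N) - (a * b) ^ 2 = x * (y - b ^ 2) + b ^ 2 * (x - a ^ 2) := by
      rw [Units.val_mul]; ring
    rw [this]
    refine Valuation.map_add_lt _ ?_ ?_
    · rwa [map_mul, h1, one_mul]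
    · rwa [map_mul, map_pow, hb, one_pow, one_mul]
  inv_mem' := by
    rintro x ⟨a, ha, hx⟩
    have h1 := valuation_eq_one_of_sub_sq_lt ha hx
    have ha0 : a ≠ 0 := by rintro rfl; simp at ha
    refine ⟨a⁻¹, by rw [map_inv₀, ha, inv_one], ?_⟩
    have : ((x⁻¹ : Nˣ) : N) - a⁻¹ ^ 2 = (x : N)⁻¹ * (a⁻¹) ^ 2 * -(x - a ^ 2) := by
      have := x.ne_zero
      rw [Units.val_inv_eq_inv_val]
      field_simp
      ring
    rw [this, map_mul, map_mul, map_pow, map_inv₀, map_inv₀, h1, ha, Valuation.map_neg]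
    simpa using hx

theorem mem_localSquares_iff {v : HeightOneSpectrum (𝓞 N)} {u : Nˣ}
    (hu : v.valuation N (u : N) = 1) {x : 𝓞 N} (hx : v.valuation N (x - u : N) < 1) :
    u ∈ localSquares v ↔ ∃ a : 𝓞 N, a ^ 2 - x ∈ v.asIdeal := by
  have hint (y : 𝓞 N) : y ∈ v.asIdeal ↔ v.valuation N (y : N) < 1 :=
    (v.valuation_lt_one_iff_mem y).symm
  constructor
  · rintro ⟨a, ha, hau⟩
    obtain ⟨b, hb⟩ := v.exists_valuation_sub_lt_of_integer ha.le 1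
    refine ⟨b, (hint _).2 ?_⟩
    have h1 : v.valuation N (b + a : N) ≤ 1 :=
      Valuation.map_add_le _ (v.valuation_le_one b) ha.le
    have : ((b ^ 2 - x : 𝓞 N) : N) = (b - a) * (b + a) + -(u - a ^ 2) + -(x - u) := by
      push_cast; ring
    rw [this]
    refine Valuation.map_add_lt _ (Valuation.map_add_lt _ ?_ ?_) ?_
    · rw [map_mul]
      exact mul_lt_one_of_lt_of_le hb h1
    · rwa [Valuation.map_neg]
    · rwa [Valuation.map_neg]
  · rintro ⟨a, ha⟩
    rw [hint] at ha
    have h2 : v.valuation N (u - (a : N) ^ 2 : N) < 1 := by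
      have : (u - (a : N) ^ 2 : N) = -((a ^ 2 - x : 𝓞 N) : N) + -(x - u) := by
        push_cast; ring
      rw [this]
      refine Valuation.map_add_lt _ ?_ ?_ <;> rwa [Valuation.map_neg]
    refine ⟨a, ?_, h2⟩
    have h3 := Valuation.map_sub_eq_of_lt_right (v.valuation N) (x := (u : N) - (a : N) ^ 2)
      (y := u) (by rwa [hu])
    rw [sub_sub_cancel_left, Valuation.map_neg, hu, map_pow] at h3
    exact (pow_left_inj₀ zero_le zero_le two_ne_zero).1 (h3.trans (one_pow 2).symm)

theorem mul_mem_localSquares {v : HeightOneSpectrum (𝓞 N)} {u u' : Nˣ}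
    (hu : v.valuation N (u : N) = 1) (hu' : v.valuation N (u' : N) = 1)
    (h : u ∉ localSquares v) (h' : u' ∉ localSquares v) : u * u' ∈ localSquares v := by
  obtain ⟨x, hx⟩ := v.exists_valuation_sub_lt_of_integer hu.le 1
  obtain ⟨x', hx'⟩ := v.exists_valuation_sub_lt_of_integer hu'.le 1
  let _ : Field (𝓞 N ⧸ v.asIdeal) := Ideal.Quotient.field _
  have : Finite (𝓞 N ⧸ v.asIdeal) := v.asIdeal.finiteQuotientOfFreeOfNeBot v.ne_bot
  have hsq (z : 𝓞 N) : (∃ a : 𝓞 N, a ^ 2 - z ∈ v.asIdeal) ↔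
      IsSquare (Ideal.Quotient.mk v.asIdeal z) := by
    rw [isSquare_iff_exists_sq, Ideal.Quotient.mk_surjective.exists]
    simp_rw [← Ideal.Quotient.eq, map_pow, eq_comm]
  rw [mem_localSquares_iff hu hx, hsq] at h
  rw [mem_localSquares_iff hu' hx', hsq] at h'
  have hxx : v.valuation N ((x * x' : 𝓞 N) - (u * u' : Nˣ) : N) < 1 := by
    have : ((x * x' : 𝓞 N) - (u * u' : Nˣ) : N) = (x - u) * x' + u * (x' - u') := by
      push_cast; ring
    rw [this]
    refine Valuation.map_add_lt _ ?_ ?_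
    · rw [map_mul]
      exact mul_lt_one_of_lt_of_le hx (v.valuation_le_one x')
    · rwa [map_mul, hu, one_mul]
  rw [mem_localSquares_iff (by rw [Units.val_mul, map_mul, hu, hu', one_mul]) hxx, hsq, map_mul]
  exact isSquare_mul_of_not_isSquare h h'

theorem relIndex_localSquares_dvd_two (v : HeightOneSpectrum (𝓞 N)) {V : Subgroup Nˣ}
    (hV : ∀ x ∈ V, v.valuation N (x : N) = 1) : (localSquares v).relIndex V ∣ 2 := by
  rw [Subgroup.relIndex_dvd_two_iff]
  by_cases h : ∃ a ∈ V, a ∉ localSquares v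
  · obtain ⟨a, ha, ha'⟩ := h
    refine ⟨a, ha, fun b hb ↦ ?_⟩
    by_contra! h
    exact h.1 (mul_mem_localSquares (hV _ hb) (hV _ ha) h.2 ha')
  · push Not at h
    exact ⟨1, V.one_mem, fun b hb ↦ .inr (h b hb)⟩

theorem relIndex_iInf_localSquares_le (T : Finset (HeightOneSpectrum (𝓞 N))) {V : Subgroup Nˣ}
    (hV : ∀ v ∈ T, ∀ x ∈ V, v.valuation N (x : N) = 1) :
    (⨅ v ∈ T, localSquares v).relIndex V ≠ 0 ∧ (⨅ v ∈ T, localSquares v).relIndex V ≤ 2 ^ T.card := by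
  classical
  induction T using Finset.induction_on with
  | empty => simp
  | insert v T hv ih =>
    obtain ⟨h1, h2⟩ := ih fun w hw ↦ hV w (Finset.mem_insert_of_mem hw)
    have h3 := relIndex_localSquares_dvd_two v (hV v (Finset.mem_insert_self _ _))
    rw [Finset.iInf_insert, Finset.card_insert_of_notMem hv, pow_succ']
    refine ⟨Subgroup.relIndex_inf_ne_zero (fun h ↦ by simp [h] at h3) h1, ?_⟩
    exact Subgroup.relIndex_inf_le.trans (Nat.mul_le_mul (Nat.le_of_dvd two_pos h3) h2)

end LocalSquares

section LocalSquares

variable {F K : Type*} [Field F] [NumberField F] [Field K] [NumberField K] [Algebra F K]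
  [Algebra.IsQuadraticExtension F K] {δ : K}

theorem exists_mul_sq_eq_integer (u : Fˣ) : ∃ (g : Fˣ) (c : 𝓞 F), (c : F) = u * g ^ 2 := by
  obtain ⟨a, b, hb, hab⟩ := IsFractionRing.div_surjective (A := 𝓞 F) (u : F)
  have hb0 : (b : F) ≠ 0 := by simpa using nonZeroDivisors.ne_zero hb
  refine ⟨Units.mk0 (b : F) hb0, a * b, ?_⟩
  rw [← hab, Units.val_mk0]
  push_cast
  field_simp

theorem mem_squares_sUnit {S : Set (HeightOneSpectrum (𝓞 F))} {u : Fˣ} (hu : u ∈ S.unit F)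
    (h : IsSquare (u : F)) : u ∈ (S.unit F).squares := by
  obtain ⟨a, ha⟩ := h
  have ha0 : a ≠ 0 := by
    rintro rfl
    simp at ha
  refine ⟨Units.mk0 a ha0, fun v hv ↦ ?_, Units.ext (by simp [ha, sq])⟩
  have h1 : v.valuation F (u : F) = 1 := hu v hv
  rw [ha, ← sq, map_pow] at h1
  exact (pow_left_inj₀ zero_le zero_le two_ne_zero).1 (h1.trans (one_pow 2).symm)

theorem sq_mem_localSquares {v : HeightOneSpectrum (𝓞 F)} {g : Fˣ}
    (hg : v.valuation F (g : F) = 1) : g ^ 2 ∈ localSquares v :=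
  ⟨g, hg, by simp⟩

theorem squares_sUnit_le_localSquares {S : Set (HeightOneSpectrum (𝓞 F))}
    {v : HeightOneSpectrum (𝓞 F)} (hv : v ∉ S) : (S.unit F).squares ≤ localSquares v := by
  rintro _ ⟨a, ha, rfl⟩
  exact sq_mem_localSquares (ha v hv)

theorem exists_finset_relIndex_localSquares (S : Finset (HeightOneSpectrum (𝓞 F)))
    {d : 𝓞 F} (hd : ¬ IsSquare (d : F)) (hδ : δ ^ 2 = algebraMap F K d) {d' : Fˣ}
    (hd' : (d' : F) = d) (hdS : d' ∈ (S : Set (HeightOneSpectrum (𝓞 F))).unit F) (n : ℕ)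
    (hn : n ≤ Units.rank F + S.card) :
    ∃ T : Finset (HeightOneSpectrum (𝓞 F)), T.card = n ∧ Disjoint S T ∧
      (∀ v ∈ T, d' ∈ localSquares v ∧ ∃ e, e ^ 2 - d ∈ v.asIdeal) ∧
      (⨅ v ∈ T, localSquares v).relIndex ((S : Set (HeightOneSpectrum (𝓞 F))).unit F) = 2 ^ n := by
  classical
  set U := (S : Set (HeightOneSpectrum (𝓞 F))).unit F with hU
  induction n with
  | zero => exact ⟨∅, by simp⟩
  | succ n ih =>
    obtain ⟨T, hTn, hST, hT, hidx⟩ := ih (by omega)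
    set I : Subgroup Fˣ := ⨅ v ∈ T, localSquares v with hI
    have hsqI : U.squares ≤ I := le_iInf₂ fun v hv ↦
      squares_sUnit_le_localSquares fun h ↦ Finset.disjoint_left.1 hST h hv
    have hdI : d' ∈ I := by
      simp only [hI, Subgroup.mem_iInf]
      exact fun v hv ↦ (hT v hv).1
    have key : ∃ u ∈ I ⊓ U, ¬ IsSquare (u : F) ∧ ¬ IsSquare (u * d : F) := by
      by_contra! h
      have h1 : U.squares.relIndex (I ⊓ U) ∣ 2 := by
        rw [Subgroup.relIndex_dvd_two_iff]
        refine ⟨d', ⟨hdI, hdS⟩, fun b hb ↦ ?_⟩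
        by_cases hb' : IsSquare (b : F)
        · exact .inr (mem_squares_sUnit hb.2 hb')
        · refine .inl (mem_squares_sUnit (mul_mem hb.2 hdS) ?_)
          rw [Units.val_mul, hd']
          exact h b hb hb'
      have h2 := Subgroup.relIndex_mul_relIndex U.squares (I ⊓ U) U
        (le_inf hsqI U.squares_le) inf_le_right
      rw [Subgroup.inf_relIndex_right, hidx, relIndex_squares_sUnit] at h2
      have h3 : 2 ^ (Units.rank F + Nat.card (S : Set (HeightOneSpectrum (𝓞 F))) + 1) ∣
          2 ^ (n + 1) := by
        rw [← h2, pow_succ']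
        exact mul_dvd_mul_right h1 _
      rw [Nat.pow_dvd_pow_iff_le_right (by norm_num), Nat.card_coe_set_eq,
        Set.ncard_coe_finset] at h3
      omega
    obtain ⟨u, ⟨huI, huU⟩, hu, hud⟩ := key
    obtain ⟨g, c, hc⟩ := exists_mul_sq_eq_integer u
    have hsq {x y : F} (h : IsSquare (x * y)) (hy : y ≠ 0) (hy' : IsSquare y) : IsSquare x := by
      have := h.div hy'
      rwa [mul_div_cancel_right₀ _ hy] at this
    have hg2 : (g : F) ^ 2 ≠ 0 := pow_ne_zero _ g.ne_zero
    have hg2' : IsSquare ((g : F) ^ 2) := ⟨g, sq _⟩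
    obtain ⟨q, hqS, ⟨e, he⟩, hq⟩ := exists_isSquare_mod_not_isSquare_mod
      (S ∪ T ∪ (finite_setOf_ord_ne_zero g).toFinset) (u := c) hd hδ
      (fun h ↦ hu (hsq (hc ▸ h) hg2 hg2'))
      (fun h ↦ hud (hsq (by rw [hc] at h; convert h using 1; ring) hg2 hg2'))
    simp only [Finset.mem_union, Set.Finite.mem_toFinset, Set.mem_ofPred_eq, not_or, not_not] at hqS
    obtain ⟨⟨hqS, hqT⟩, hqg⟩ := hqS
    rw [← HeightOneSpectrum.valuation_eq_one_iff_ord] at hqg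
    have hqu : q.valuation F (u : F) = 1 := huU q hqS
    have hq_mem {x : Fˣ} {y : 𝓞 F} (hx : q.valuation F (x : F) = 1) (hxy : (y : F) = x) :
        x ∈ localSquares q ↔ ∃ a : 𝓞 F, a ^ 2 - y ∈ q.asIdeal :=
      mem_localSquares_iff hx (by rw [hxy]; simp)
    have hnot : u ∉ localSquares q := by
      intro h
      have h1 := mul_mem h (sq_mem_localSquares hqg)
      rw [hq_mem (y := c) (by simp [hqu, hqg]) (by simp [hc])] at h1
      obtain ⟨a, ha⟩ := h1
      exact hq a ha
    have hdq : d' ∈ localSquares q := (hq_mem (hdS q hqS) hd'.symm).2 ⟨e, he⟩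
    refine ⟨insert q T, by rw [Finset.card_insert_of_notMem hqT, hTn], ?_, ?_, ?_⟩
    · rw [Finset.disjoint_insert_right]
      exact ⟨hqS, hST⟩
    · intro v hv
      obtain rfl | hv := Finset.mem_insert.1 hv
      · exact ⟨hdq, e, he⟩
      · exact hT v hv
    · rw [Finset.iInf_insert, ← Subgroup.relIndex_inf_mul_relIndex, hidx, pow_succ']
      congr 1
      have h1 := relIndex_localSquares_dvd_two q (V := I ⊓ U) fun x hx ↦ hx.2 q hqS
      refine ((Nat.dvd_prime Nat.prime_two).1 h1).resolve_left fun h ↦ ?_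
      exact hnot (Subgroup.relIndex_eq_one.1 h ⟨huI, huU⟩)

theorem two_pow_card_le_relIndex_localSquares {S T T' : Finset (HeightOneSpectrum (𝓞 F))}
    (hST : Disjoint S T) (hT : (⨅ v ∈ T, localSquares v).relIndex
      ((S : Set (HeightOneSpectrum (𝓞 F))).unit F) = 2 ^ T.card) (hT' : T' ⊆ T) :
    2 ^ T'.card ≤ (⨅ v ∈ T', localSquares v).relIndex
      ((S : Set (HeightOneSpectrum (𝓞 F))).unit F) := by
  classical
  have h1 : (⨅ v ∈ T, localSquares v) = (⨅ v ∈ T', localSquares v) ⊓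
      ⨅ v ∈ T \ T', localSquares v := by
    rw [← Finset.iInf_union, Finset.union_sdiff_of_subset hT']
  obtain ⟨-, h2⟩ := relIndex_iInf_localSquares_le (T \ T')
    (V := (S : Set (HeightOneSpectrum (𝓞 F))).unit F) fun v hv x hx ↦
      hx v fun h ↦ Finset.disjoint_left.1 hST h (Finset.mem_sdiff.1 hv).1
  have h3 := Finset.card_sdiff_add_card_eq_card hT'
  rw [h1] at hT
  refine Nat.le_of_mul_le_mul_right (c := 2 ^ (T \ T').card) ?_ (by positivity)
  rw [← pow_add, add_comm, h3, ← hT]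
  exact Subgroup.relIndex_inf_le.trans (Nat.mul_le_mul_left _ h2)

end LocalSquares

section Contradiction

variable {N : Type*} [Field N] [NumberField N]

/-- The group of elements which are positive at a given real place. -/
def positiveAt {v : InfinitePlace N} (hv : v.IsReal) : Subgroup Nˣ where
  carrier := {x | 0 < InfinitePlace.embedding_of_isReal hv x}
  one_mem' := by simp
  mul_mem' {x y} hx hy := by
    simp only [Set.mem_ofPred_eq, Units.val_mul, map_mul] at *
    exact mul_pos hx hy
  inv_mem' {x} hx := by
    simp only [Set.mem_ofPred_eq, Units.val_inv_eq_inv_val, map_inv₀] at *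
    exact inv_pos.2 hx

theorem mem_positiveAt {v : InfinitePlace N} {hv : v.IsReal} {x : Nˣ} :
    x ∈ positiveAt hv ↔ 0 < InfinitePlace.embedding_of_isReal hv x := Iff.rfl

theorem notMem_positiveAt {v : InfinitePlace N} {hv : v.IsReal} {x : Nˣ} :
    x ∉ positiveAt hv ↔ InfinitePlace.embedding_of_isReal hv x < 0 := by
  rw [mem_positiveAt, not_lt]
  exact ⟨fun h ↦ lt_of_le_of_ne h (by simp), le_of_lt⟩

theorem relIndex_positiveAt_eq_two {v : InfinitePlace N} (hv : v.IsReal) {V : Subgroup Nˣ}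
    {d : Nˣ} (hd : d ∈ V) (hdv : d ∉ positiveAt hv) : (positiveAt hv).relIndex V = 2 := by
  rw [Subgroup.relIndex_eq_two_iff_exists_notMem_and]
  refine ⟨d, hd, hdv, fun b _ ↦ ?_⟩
  by_cases h : b ∈ positiveAt hv
  · exact .inr h
  · left
    rw [notMem_positiveAt] at h hdv
    rw [mem_positiveAt, Units.val_mul, map_mul]
    exact mul_pos_of_neg_of_neg h hdv

theorem normFormSubgroup_inf_le_localSquares {S : Set (HeightOneSpectrum (𝓞 N))} {c : Nˣ}
    {v : HeightOneSpectrum (𝓞 N)} (hv : v ∉ S) (hc : ¬ Even (v.ord N (.ofMul c))) :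
    normFormSubgroup (c : N) ⊓ S.unit N ≤ localSquares v := by
  rintro u ⟨⟨a, b, hu⟩, huS⟩
  have huv : v.valuation N (u : N) = 1 := huS v hv
  have h1 : v.valuation N (c * b ^ 2) ≠ 1 := by
    intro h
    have hb : b ≠ 0 := by rintro rfl; simp at h
    have h2 := (v.valuation_eq_one_iff_ord (c * Units.mk0 b hb ^ 2)).1 (by simpa using h)
    rw [ofMul_mul, ofMul_pow, map_add, map_nsmul] at h2
    exact hc ⟨-v.ord N (.ofMul (Units.mk0 b hb)), by rw [two_nsmul] at h2; omega⟩
  have h2 : v.valuation N (a ^ 2) ≠ v.valuation N (c * b ^ 2) := by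
    intro h
    by_cases hb : b = 0
    · have ha : a = 0 := by simpa [hb] using h
      simp [ha, hb] at hu
    have ha : a ≠ 0 := by
      rintro rfl
      simp [hb] at h
    have h3 := (v.valuation_eq_one_iff_ord (c * Units.mk0 b hb ^ 2 / Units.mk0 a ha ^ 2)).1
      (by
        rw [Units.val_div_eq_div_val, map_div₀, div_eq_one_iff_eq (by simpa using ha)]
        simpa using h.symm)
    rw [ofMul_div, ofMul_mul, ofMul_pow, ofMul_pow, map_sub, map_add, map_nsmul, map_nsmul,
      two_nsmul, two_nsmul] at h3
    exact hc ⟨v.ord N (.ofMul (Units.mk0 a ha)) - v.ord N (.ofMul (Units.mk0 b hb)), by omega⟩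
  have h3 := (v.valuation N).map_add_of_distinct_val (x := a ^ 2) (y := -(c * b ^ 2))
    (by rwa [Valuation.map_neg])
  rw [Valuation.map_neg, ← sub_eq_add_neg, ← hu, huv] at h3
  have h4 : v.valuation N (a ^ 2) = 1 := by
    obtain h | h := max_choice (v.valuation N (a ^ 2)) (v.valuation N (c * b ^ 2))
    · rw [h3, h]
    · exact (h1 (by rw [h3, h])).elim
  refine ⟨a, ?_, ?_⟩
  · rw [map_pow] at h4
    exact (pow_left_inj₀ zero_le zero_le two_ne_zero).1 (h4.trans (one_pow 2).symm)
  · rw [hu, sub_sub_cancel_left, Valuation.map_neg]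
    exact lt_of_le_of_ne (h3 ▸ le_max_right _ _) h1

theorem normFormSubgroup_le_positiveAt {v : InfinitePlace N} {hv : v.IsReal} {c : Nˣ}
    (hc : c ∉ positiveAt hv) : normFormSubgroup (c : N) ≤ positiveAt hv := by
  rintro u ⟨a, b, hu⟩
  rw [notMem_positiveAt] at hc
  have h0 : InfinitePlace.embedding_of_isReal hv u ≠ 0 := by simp
  refine lt_of_le_of_ne ?_ h0.symm
  rw [hu, map_sub, map_mul, map_pow, map_pow]
  nlinarith [mul_nonneg (neg_nonneg.2 hc.le) (sq_nonneg (InfinitePlace.embedding_of_isReal hv b)),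
    sq_nonneg (InfinitePlace.embedding_of_isReal hv a)]

theorem isSquare_of_even_ord (hN : ∀ v : InfinitePlace N, v.IsReal)
    {S T : Finset (HeightOneSpectrum (𝓞 N))} (hST : Disjoint S T)
    (hT : (⨅ v ∈ T, localSquares v).relIndex
      ((S : Set (HeightOneSpectrum (𝓞 N))).unit N) = 2 ^ T.card)
    (h2 : ∀ v ∉ S, (2 : 𝓞 N) ∉ v.asIdeal) (hS : HasUniformizers (S : Set (HeightOneSpectrum (𝓞 N))))
    {d : Nˣ} (hdS : d ∈ (S : Set (HeightOneSpectrum (𝓞 N))).unit N)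
    (hdT : ∀ v ∈ T, d ∈ localSquares v) {P : Finset (InfinitePlace N)} (hP1 : P.card ≤ 1)
    (hdP : ∀ v ∈ P, d ∉ positiveAt (hN v)) {c : Nˣ} {c' : 𝓞 N} (hc' : (c' : N) = c)
    (hcS : ∀ v ∉ S, v ∉ T → Even (v.ord N (.ofMul c)))
    {y z : 𝓞 N} (hy : ∀ v ∈ S, y ∉ v.asIdeal) (hz : ∀ v ∈ S, z ∈ v.asIdeal)
    (hyz : y ^ 2 - c' = 4 * z) (hcP : ∀ v, c ∈ positiveAt (hN v) ↔ v ∉ P) :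
    IsSquare (c : N) := by
  classical
  by_contra hc
  set U := (S : Set (HeightOneSpectrum (𝓞 N))).unit N with hU
  set T' := {v ∈ T | ¬ Even (v.ord N (.ofMul c))} with hT'
  have hT'T : T' ⊆ T := Finset.filter_subset _ _
  obtain ⟨hne, hle⟩ := two_mul_relIndex_normFormSubgroup_le hN hc hc' S T'
    (hST.mono_right hT'T) h2 hS (fun v hvS hvT' ↦ by
      by_cases hvT : v ∈ T
      · simpa [hT', hvT] using hvT'
      · exact hcS v hvS hvT) hy hz hyz P fun v hv ↦ (hcP v).2 hv
  set I : Subgroup Nˣ := ⨅ v ∈ T', localSquares v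
  have hI := two_pow_card_le_relIndex_localSquares hST hT hT'T
  have hdI : d ∈ I := Subgroup.mem_iInf.2 fun w ↦ Subgroup.mem_iInf.2 fun hw ↦ hdT w (hT'T hw)
  have hlow : 2 ^ (T'.card + P.card) ≤ ((⨅ v ∈ P, positiveAt (hN v)) ⊓ I).relIndex U := by
    obtain hP | hP := Nat.le_one_iff_eq_zero_or_eq_one.1 hP1
    · rw [Finset.card_eq_zero] at hP
      simpa [hP] using hI
    · obtain ⟨v, rfl⟩ := Finset.card_eq_one.1 hP
      rw [hP, Finset.iInf_singleton, ← Subgroup.relIndex_inf_mul_relIndex,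
        relIndex_positiveAt_eq_two _ (Subgroup.mem_inf.2 ⟨hdI, hdS⟩) (hdP v (by simp)), pow_succ']
      exact Nat.mul_le_mul_left _ hI
  have hsub : normFormSubgroup (c : N) ⊓ U ≤ (⨅ v ∈ P, positiveAt (hN v)) ⊓ I := by
    refine le_inf (inf_le_left.trans (le_iInf₂ fun v hv ↦ ?_)) (le_iInf₂ fun v hv ↦ ?_)
    · exact normFormSubgroup_le_positiveAt fun h ↦ (hcP v).1 h hv
    · exact normFormSubgroup_inf_le_localSquares
        (fun h ↦ Finset.disjoint_left.1 hST h (hT'T hv)) (Finset.mem_filter.1 hv).2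
  have h3 := Subgroup.relIndex_le_of_le_left hsub (by rwa [Subgroup.inf_relIndex_right])
  rw [Subgroup.inf_relIndex_right] at h3
  have h4 : 0 < (normFormSubgroup (c : N)).relIndex U := Nat.pos_of_ne_zero hne
  rw [← hU] at hle
  omega

end Contradiction

section Approximation

variable {N : Type*} [Field N] [NumberField N]

theorem IsDedekindDomain.HeightOneSpectrum.le_ord_iff (v : HeightOneSpectrum (𝓞 N)) (x : Nˣ)
    {y : 𝓞 N} (hy : (y : N) = x) (n : ℕ) : (n : ℤ) ≤ v.ord N (.ofMul x) ↔ y ∈ v.asIdeal ^ n := by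
  have hy' : v.intValuation y = v.valuation N (x : N) := by
    rw [← hy]
    exact (v.valuation_of_algebraMap y).symm
  rw [← v.intValuation_le_pow_iff_mem, hy', v.valuation_eq_exp_ord, WithZero.exp_le_exp, neg_le_neg_iff]

theorem IsDedekindDomain.HeightOneSpectrum.ord_eq_zero_iff (v : HeightOneSpectrum (𝓞 N)) (x : Nˣ)
    {y : 𝓞 N} (hy : (y : N) = x) : v.ord N (.ofMul x) = 0 ↔ y ∉ v.asIdeal := by
  rw [← v.valuation_eq_one_iff_ord, ← hy]
  exact v.valuation_eq_one_iff_notMem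

theorem exists_forall_ord_eq_natCast (S : Finset (HeightOneSpectrum (𝓞 N)))
    (n : HeightOneSpectrum (𝓞 N) → ℕ) : ∃ h : Nˣ, ∀ v ∈ S, v.ord N (.ofMul h) = n v := by
  obtain rfl | ⟨v₀, hv₀⟩ := S.eq_empty_or_nonempty
  · exact ⟨1, by simp⟩
  choose x hx hx' using fun v : HeightOneSpectrum (𝓞 N) ↦
    v.asIdeal.exists_mem_pow_notMem_pow_succ v.ne_bot v.isPrime.ne_top (n v)
  obtain ⟨y, hy⟩ := IsDedekindDomain.exists_forall_sub_mem_ideal (s := S)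
    (fun v ↦ v.asIdeal) (fun v ↦ n v + 1) (fun v _ ↦ v.prime)
    (fun v _ w _ h h' ↦ h (HeightOneSpectrum.ext h')) fun v ↦ x v
  have hle {v} (hv : v ∈ S) : y ∈ v.asIdeal ^ n v := by
    have := add_mem (Ideal.pow_le_pow_right (Nat.le_succ _) (hy v hv)) (hx v)
    rwa [sub_add_cancel] at this
  have hlt {v} (hv : v ∈ S) : y ∉ v.asIdeal ^ (n v + 1) := fun h ↦ hx' v (by
    have := sub_mem h (hy v hv)
    rwa [sub_sub_cancel] at this)
  have hy0 : (y : N) ≠ 0 := by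
    intro h
    obtain rfl : y = 0 := RingOfIntegers.ext h
    exact hlt hv₀ (zero_mem _)
  refine ⟨Units.mk0 y hy0, fun v hv ↦ ?_⟩
  have h1 := (v.le_ord_iff (Units.mk0 y hy0) rfl _).2 (hle hv)
  have h2 := mt (v.le_ord_iff (Units.mk0 y hy0) rfl _).1 (hlt hv)
  push_cast at h2
  omega

theorem exists_forall_ord_eq_intCast (S : Finset (HeightOneSpectrum (𝓞 N)))
    (n : HeightOneSpectrum (𝓞 N) → ℤ) : ∃ h : Nˣ, ∀ v ∈ S, v.ord N (.ofMul h) = n v := by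
  obtain ⟨a, ha⟩ := exists_forall_ord_eq_natCast S fun v ↦ (n v).toNat
  obtain ⟨b, hb⟩ := exists_forall_ord_eq_natCast S fun v ↦ (-n v).toNat
  refine ⟨a / b, fun v hv ↦ ?_⟩
  rw [ofMul_div, map_sub, ha v hv, hb v hv]
  omega

theorem exists_mul_sq_eq_integer_notMem {S : Finset (HeightOneSpectrum (𝓞 N))} {x : Nˣ}
    (hx : ∀ v ∈ S, Even (v.ord N (.ofMul x))) :
    ∃ (g : Nˣ) (c : 𝓞 N), (c : N) = x * g ^ 2 ∧ ∀ v ∈ S, c ∉ v.asIdeal := by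
  obtain ⟨h, hh⟩ := exists_forall_ord_eq_intCast S fun v ↦ v.ord N (.ofMul x) / 2
  have hy (v) (hv : v ∈ S) : v.ord N (.ofMul (x / h ^ 2)) = 0 := by
    rw [ofMul_div, ofMul_pow, map_sub, map_nsmul, hh v hv, two_nsmul]
    obtain ⟨k, hk⟩ := hx v hv
    omega
  set y := x / h ^ 2 with hy_def
  obtain ⟨e, ⟨c, hce⟩, heS⟩ : ∃ e : 𝓞 N, (∃ c : 𝓞 N, (y : N) * algebraMap (𝓞 N) N e = algebraMap (𝓞 N) N c) ∧ ∀ v ∈ S, e ∉ v.asIdeal := by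
    let D : Ideal (𝓞 N) :=
      { carrier := {e | ∃ c : 𝓞 N, (y : N) * algebraMap (𝓞 N) N e = algebraMap (𝓞 N) N c}
        zero_mem' := ⟨0, by simp⟩
        add_mem' := by
          rintro a b ⟨c, hc⟩ ⟨c', hc'⟩
          exact ⟨c + c', by rw [map_add, map_add, mul_add, hc, hc']⟩
        smul_mem' := by
          rintro r a ⟨c, hc⟩
          exact ⟨r * c, by rw [smul_eq_mul, map_mul, map_mul, ← hc]; ring⟩ }
    by_contra! hcon
    obtain ⟨v₀, hv₀, -⟩ := hcon 0 ⟨0, by simp⟩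
    have h1 : (D : Set (𝓞 N)) ⊆ ⋃ v ∈ (S : Set (HeightOneSpectrum (𝓞 N))), v.asIdeal := by
      intro e he
      simpa using hcon e he
    obtain ⟨v, hv, hDv⟩ := (Ideal.subset_union_prime v₀ v₀ fun v _ _ _ ↦ v.isPrime).1 h1
    obtain ⟨n, ⟨e, he⟩, hne⟩ := v.exists_primeCompl_mul_eq_of_integer (y : N)
      ((v.valuation_eq_one_iff_ord y).2 (hy v hv)).le
    exact he (hDv ⟨n, hne⟩)
  by_cases hS : S = ∅
  · subst hS
    obtain ⟨g, c, hc⟩ := exists_mul_sq_eq_integer x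
    exact ⟨g, c, hc, by simp⟩
  obtain ⟨v₀, hv₀⟩ := Finset.nonempty_of_ne_empty hS
  have he0 : (e : N) ≠ 0 := by
    intro h
    obtain rfl : e = 0 := RingOfIntegers.ext h
    exact heS v₀ hv₀ (zero_mem _)
  refine ⟨Units.mk0 (e : N) he0 / h, c * e, ?_, fun v hv ↦ ?_⟩
  · change algebraMap (𝓞 N) N (c * e) = _
    rw [map_mul, ← hce, hy_def]
    push_cast
    rw [Units.val_mk0]
    field_simp
  · rw [v.isPrime.mul_mem_iff_mem_or_mem, not_or]
    refine ⟨?_, heS v hv⟩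
    rw [← v.ord_eq_zero_iff (y * Units.mk0 (e : N) he0) hce.symm, ofMul_mul, map_add,
      hy v hv, zero_add, v.ord_eq_zero_iff _ rfl]
    exact heS v hv

end Approximation

section SquaresModFour

variable {N : Type*} [Field N] [NumberField N]

/-- The product of the primes in a finite set. -/
noncomputable abbrev primesInf (S : Finset (HeightOneSpectrum (𝓞 N))) : Ideal (𝓞 N) :=
  S.inf HeightOneSpectrum.asIdeal

theorem mem_primesInf {S : Finset (HeightOneSpectrum (𝓞 N))} {z : 𝓞 N} :
    z ∈ primesInf S ↔ ∀ v ∈ S, z ∈ v.asIdeal := by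
  simp [primesInf, Submodule.mem_finsetInf]

theorem primesInf_ne_bot (S : Finset (HeightOneSpectrum (𝓞 N))) : primesInf S ≠ ⊥ := by
  intro h
  have h1 : ∏ v ∈ S, v.asIdeal ≤ primesInf S := Ideal.prod_le_inf
  rw [h, le_bot_iff, ← Ideal.zero_eq_bot, Finset.prod_eq_zero_iff] at h1
  obtain ⟨v, -, hv⟩ := h1
  exact v.ne_bot hv

/-- Four times the product of the primes in a finite set. -/
noncomputable abbrev fourModulus (S : Finset (HeightOneSpectrum (𝓞 N))) : Ideal (𝓞 N) :=
  Ideal.span {4} * primesInf S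

theorem mem_fourModulus {S : Finset (HeightOneSpectrum (𝓞 N))} {x : 𝓞 N} :
    x ∈ fourModulus S ↔ ∃ z, (∀ v ∈ S, z ∈ v.asIdeal) ∧ x = 4 * z := by
  simp only [fourModulus, Ideal.mem_span_singleton_mul, mem_primesInf, eq_comm]

instance (S : Finset (HeightOneSpectrum (𝓞 N))) : Finite (𝓞 N ⧸ fourModulus S) := by
  refine Ideal.finiteQuotientOfFreeOfNeBot _ ?_
  rw [← Ideal.zero_eq_bot, mul_ne_zero_iff]
  exact ⟨by simp, primesInf_ne_bot S⟩

theorem notMem_of_isUnit_mk {S : Finset (HeightOneSpectrum (𝓞 N))} {c : 𝓞 N}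
    (hc : IsUnit (Ideal.Quotient.mk (fourModulus S) c)) {v} (hv : v ∈ S) : c ∉ v.asIdeal := by
  intro h
  have hle : fourModulus S ≤ v.asIdeal := fun x hx ↦ by
    obtain ⟨z, hz, rfl⟩ := mem_fourModulus.1 hx
    exact v.asIdeal.mul_mem_left _ (hz v hv)
  have h1 := hc.map (Ideal.Quotient.factor hle)
  rw [Ideal.Quotient.factor_mk, Ideal.Quotient.eq_zero_iff_mem.2 h] at h1
  exact not_isUnit_zero h1

theorem isUnit_mk_of_notMem {S : Finset (HeightOneSpectrum (𝓞 N))}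
    (h2 : ∀ v ∉ S, (2 : 𝓞 N) ∉ v.asIdeal) {c : 𝓞 N} (hc : ∀ v ∈ S, c ∉ v.asIdeal) :
    IsUnit (Ideal.Quotient.mk (fourModulus S) c) := by
  by_contra h
  obtain ⟨M, hM, hcM⟩ := exists_max_ideal_of_mem_nonunits h
  set M' := M.comap (Ideal.Quotient.mk (fourModulus S)) with hM'
  have hMp : M'.IsPrime := Ideal.comap_isPrime _ _
  have hle : fourModulus S ≤ M' := fun x hx ↦ by
    rw [hM', Ideal.mem_comap, Ideal.Quotient.eq_zero_iff_mem.2 hx]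
    exact zero_mem _
  have hM0 : M' ≠ ⊥ := by
    intro h
    rw [h, le_bot_iff, ← Ideal.zero_eq_bot, mul_eq_zero] at hle
    exact hle.elim (by simp) (primesInf_ne_bot S)
  let w : HeightOneSpectrum (𝓞 N) := ⟨M', hMp, hM0⟩
  refine hc w ?_ hcM
  obtain h4 | h4 := hMp.mul_le.1 hle
  · by_contra hw
    rw [Ideal.span_singleton_le_iff_mem] at h4
    refine h2 w hw (hMp.mem_of_pow_mem 2 ?_)
    convert h4 using 1
    norm_num
  · obtain ⟨v, hv, hvM⟩ := hMp.inf_le'.1 h4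
    have : v = w := HeightOneSpectrum.ext (v.isMaximal.eq_of_le hMp.ne_top hvM)
    exact this ▸ hv

theorem exists_eq_one_add_two_mul {S : Finset (HeightOneSpectrum (𝓞 N))}
    {u : (𝓞 N ⧸ fourModulus S)ˣ} (hu : u ^ 2 = 1) : ∃ z : 𝓞 N,
    (u : 𝓞 N ⧸ fourModulus S) = Ideal.Quotient.mk _ (1 + 2 * z) ∧
    ∀ v ∈ S, z * (z + 1) ∈ v.asIdeal := by
  obtain ⟨x, hx⟩ := Ideal.Quotient.mk_surjective (u : 𝓞 N ⧸ fourModulus S)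
  have h1 : x ^ 2 - 1 ∈ fourModulus S := by
    rw [← Ideal.Quotient.eq, map_pow, hx, map_one, ← Units.val_pow_eq_pow_val, hu, Units.val_one]
  obtain ⟨w, hw, hxw⟩ := mem_fourModulus.1 h1
  have hxw' : (x : N) ^ 2 - 1 = 4 * w := by
    have := congr_arg (algebraMap (𝓞 N) N) hxw
    simpa [map_ofNat] using this
  have hint : IsIntegral ℤ (((x : N) - 1) / 2) := by
    have : IsIntegral (𝓞 N) (((x : N) - 1) / 2) := by
      refine ⟨.X ^ 2 + .X - .C w, by monicity!, ?_⟩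
      simp only [Polynomial.eval₂_sub, Polynomial.eval₂_add, Polynomial.eval₂_X_pow,
        Polynomial.eval₂_X, Polynomial.eval₂_C]
      linear_combination hxw' / 4
    exact isIntegral_trans _ this
  let z : 𝓞 N := ⟨_, hint⟩
  have hz : (z : N) = ((x : N) - 1) / 2 := rfl
  have hxz : x = 1 + 2 * z := RingOfIntegers.ext (by
    change (x : N) = algebraMap (𝓞 N) N (1 + 2 * z)
    rw [map_add, map_one, map_mul, map_ofNat, show algebraMap (𝓞 N) N z = ((x : N) - 1) / 2 from rfl]
    ring)
  refine ⟨z, by rw [← hx, ← hxz], fun v hv ↦ ?_⟩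
  have : z * (z + 1) = w := by
    have h4 : (4 : 𝓞 N) ≠ 0 := by norm_num
    refine mul_left_cancel₀ h4 ?_
    rw [← hxw, hxz]; ring
  rw [this]
  exact hw v hv

theorem card_two_torsion_units_le (S : Finset (HeightOneSpectrum (𝓞 N))) :
    Nat.card (powMonoidHom 2 : (𝓞 N ⧸ fourModulus S)ˣ →* (𝓞 N ⧸ fourModulus S)ˣ).ker ≤
      2 ^ (S.card + finrank ℚ N) := by
  classical
  set G := (powMonoidHom 2 : (𝓞 N ⧸ fourModulus S)ˣ →* (𝓞 N ⧸ fourModulus S)ˣ).ker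
  choose z hz hzS using fun u : G ↦ exists_eq_one_add_two_mul (u := u.1) u.2
  let A : G → Finset S := fun u ↦ {v | z u ∈ v.1.asIdeal}
  have hb (u : G) : z u - z (A.invFun (A u)) ∈ primesInf S := by
    have h1 : A (A.invFun (A u)) = A u := Function.invFun_eq ⟨u, rfl⟩
    set u' := A.invFun (A u)
    rw [mem_primesInf]
    intro v hv
    have h2 : z u ∈ v.asIdeal ↔ z u' ∈ v.asIdeal := by
      have := congr_arg (⟨v, hv⟩ ∈ ·) h1
      simpa [A, eq_comm] using this
    by_cases h : z u ∈ v.asIdeal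
    · exact sub_mem h (h2.1 h)
    · have h3 := (v.isPrime.mem_or_mem (hzS u v hv)).resolve_left h
      have h4 := (v.isPrime.mem_or_mem (hzS u' v hv)).resolve_left (fun h' ↦ h (h2.2 h'))
      have := sub_mem h3 h4
      rwa [add_sub_add_right_eq_sub] at this
  let R := (nsmulAddMonoidHom 2 : primesInf S →+ primesInf S).range
  let f : G → Finset S × (primesInf S ⧸ R) := fun u ↦ (A u, QuotientAddGroup.mk ⟨_, hb u⟩)
  have hf : Function.Injective f := by
    intro u u' h
    obtain ⟨h1, h2⟩ := Prod.ext_iff.1 h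
    change A u = A u' at h1
    obtain ⟨t, ht⟩ := QuotientAddGroup.eq.1 h2
    have ht' : 2 * (t : 𝓞 N) = z u' - z u := by
      have := congr_arg Subtype.val ht
      simp only [nsmulAddMonoidHom_apply, Submodule.coe_add, Submodule.coe_neg] at this
      have hA : z (A.invFun (A u)) = z (A.invFun (A u')) := by rw [h1]
      push_cast at this
      linear_combination this + hA
    refine Subtype.ext (Units.ext ?_)
    rw [hz, hz, Ideal.Quotient.eq, mem_fourModulus]
    refine ⟨-t, mem_primesInf.1 (neg_mem t.2), ?_⟩
    linear_combination 2 * ht'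
  have hker : (nsmulAddMonoidHom 2 : primesInf S →+ primesInf S).ker = ⊥ := by
    rw [AddMonoidHom.ker_eq_bot_iff]
    intro a b hab
    refine Subtype.ext (mul_left_cancel₀ (two_ne_zero (α := 𝓞 N)) ?_)
    simpa using congr_arg Subtype.val hab
  have hR : R.index = 2 ^ finrank ℚ N := by
    change (nsmulAddMonoidHom 2 : primesInf S →+ primesInf S).range.index = _
    rw [index_range_nsmul_two, hker, AddSubgroup.card_bot, mul_one, ← RingOfIntegers.rank N]
    congr 1
    exact Ideal.finrank_eq_finrank (Module.Free.chooseBasis ℤ (𝓞 N)) _ (primesInf_ne_bot S)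
  have : Finite (primesInf S ⧸ R) := by
    have : R.FiniteIndex := ⟨by rw [hR]; positivity⟩
    infer_instance
  calc Nat.card G ≤ Nat.card (Finset S × (primesInf S ⧸ R)) := Nat.card_le_card_of_injective f hf
    _ = _ := by
      rw [Nat.card_prod, ← AddSubgroup.index, hR, Nat.card_eq_fintype_card,
        Fintype.card_finset, Fintype.card_coe, pow_add]

end SquaresModFour

section Parity

variable {N : Type*} [Field N] [NumberField N]

theorem IsDedekindDomain.HeightOneSpectrum.ord_mul_sq (v : HeightOneSpectrum (𝓞 N)) (x g : Nˣ) :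
    v.ord N (.ofMul (x * g ^ 2)) = v.ord N (.ofMul x) + 2 * v.ord N (.ofMul g) := by
  rw [ofMul_mul, ofMul_pow, map_add, map_nsmul, nsmul_eq_mul, Nat.cast_ofNat]

/-- The classes of elements which, up to squares, are prime to `S` and congruent to a square modulo
`4 ∏ v ∈ S, v`. -/
def squaresModFour (S : Finset (HeightOneSpectrum (𝓞 N))) : Subgroup Nˣ where
  carrier := {x | ∃ (g : Nˣ) (c y z : 𝓞 N), (c : N) = ↑(x * g ^ 2) ∧ (∀ v ∈ S, y ∉ v.asIdeal) ∧
    (∀ v ∈ S, z ∈ v.asIdeal) ∧ y ^ 2 - c = 4 * z}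
  one_mem' := ⟨1, 1, 1, 0, by simp, fun v _ ↦ v.asIdeal.ne_top_iff_one.1 v.isPrime.ne_top,
    by simp, by simp⟩
  mul_mem' := by
    rintro x x' ⟨g, c, y, z, hc, hy, hz, h⟩ ⟨g', c', y', z', hc', hy', hz', h'⟩
    refine ⟨g * g', c * c', y * y', z * y' ^ 2 + z' * y ^ 2 - 4 * z * z', ?_,
      fun v hv ↦ fun h ↦ (v.isPrime.mem_or_mem h).elim (hy v hv) (hy' v hv), fun v hv ↦ ?_, ?_⟩
    · rw [show ((c * c' : 𝓞 N) : N) = c * c' from map_mul (algebraMap (𝓞 N) N) c c', hc, hc']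
      push_cast
      ring
    · exact sub_mem (add_mem (Ideal.mul_mem_right _ _ (hz v hv))
        (Ideal.mul_mem_right _ _ (hz' v hv))) (Ideal.mul_mem_left _ _ (hz' v hv))
    · linear_combination y ^ 2 * h' + c' * h - 4 * z * h'
  inv_mem' := by
    rintro x ⟨g, c, y, z, hc, hy, hz, h⟩
    refine ⟨g * x, c, y, z, ?_, hy, hz, h⟩
    rw [hc]
    push_cast
    field_simp

variable (S : Finset (HeightOneSpectrum (𝓞 N)))

/-- The parities of the orders at the primes of a finite set. -/
noncomputable def ordParity : Nˣ →* Multiplicative (S → ZMod 2) :=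
  AddMonoidHom.toMultiplicativeRight
    (AddMonoidHom.pi fun v : S ↦ (Int.castAddHom (ZMod 2)).comp (v.1.ord N))

theorem ordParity_apply (x : Nˣ) (v : S) :
    (ordParity S x).toAdd v = (v.1.ord N (.ofMul x) : ZMod 2) := rfl

theorem mem_ker_ordParity {x : Nˣ} :
    x ∈ (ordParity S).ker ↔ ∀ v ∈ S, Even (v.ord N (.ofMul x)) := by
  rw [MonoidHom.mem_ker, ← toAdd_eq_zero, funext_iff, Subtype.forall]
  refine forall₂_congr fun v hv ↦ ?_
  rw [ordParity_apply, Pi.zero_apply, ZMod.intCast_zmod_eq_zero_iff_dvd, even_iff_two_dvd]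
  rfl

variable {S}

theorem squaresModFour_le : squaresModFour S ≤ (ordParity S).ker := by
  rintro x ⟨g, c, y, z, hc, hy, hz, h⟩
  rw [mem_ker_ordParity]
  intro v hv
  have h1 : v.ord N (.ofMul (x * g ^ 2)) = 0 := by
    rw [v.ord_eq_zero_iff _ hc]
    intro hcv
    refine hy v hv (v.isPrime.mem_of_pow_mem 2 ?_)
    rw [sub_eq_iff_eq_add.1 h]
    exact add_mem (Ideal.mul_mem_left _ _ (hz v hv)) hcv
  rw [v.ord_mul_sq] at h1
  exact ⟨-v.ord N (.ofMul g), by linarith⟩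

theorem sq_mem_squaresModFour (x : Nˣ) : x ^ 2 ∈ squaresModFour S :=
  ⟨x⁻¹, 1, 1, 0, by simp, fun v _ ↦ v.asIdeal.ne_top_iff_one.1 v.isPrime.ne_top, by simp, by simp⟩

theorem relIndex_squaresModFour_le (h2 : ∀ v ∉ S, (2 : 𝓞 N) ∉ v.asIdeal) :
    (squaresModFour S).relIndex (ordParity S).ker ≠ 0 ∧
    (squaresModFour S).relIndex (ordParity S).ker ≤ 2 ^ (S.card + finrank ℚ N) := by
  set E := (ordParity S).ker
  set R := (powMonoidHom 2 : (𝓞 N ⧸ fourModulus S)ˣ →* (𝓞 N ⧸ fourModulus S)ˣ).range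
  choose g c hc hcS using fun x : E ↦
    exists_mul_sq_eq_integer_notMem ((mem_ker_ordParity S).1 x.2)
  let u (x : E) : (𝓞 N ⧸ fourModulus S)ˣ := (isUnit_mk_of_notMem h2 (hcS x)).unit
  have hu (x : E) : (u x : 𝓞 N ⧸ fourModulus S) = Ideal.Quotient.mk _ (c x) := rfl
  let f : E ⧸ (squaresModFour S).subgroupOf E → (𝓞 N ⧸ fourModulus S)ˣ ⧸ R :=
    fun q ↦ QuotientGroup.mk (u q.out)
  have hf : Function.Injective f := by
    intro q q' h
    obtain ⟨t, ht⟩ := QuotientGroup.eq.1 h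
    rw [← q.out_eq, ← q'.out_eq]
    refine QuotientGroup.eq.2 ?_
    set x := q.out
    set x' := q'.out
    obtain ⟨s, hs⟩ := Ideal.Quotient.mk_surjective (t : 𝓞 N ⧸ fourModulus S)
    have h1 : (u x' : 𝓞 N ⧸ fourModulus S) = u x * t ^ 2 := by
      rw [← Units.val_pow_eq_pow_val, ← Units.val_mul]
      congr 1
      rw [← mul_inv_cancel_left (u x) (u x'), ← ht]
      rfl
    rw [hu, hu, ← hs, ← map_pow, ← map_mul, eq_comm, Ideal.Quotient.eq] at h1
    obtain ⟨z, hz, hz'⟩ := mem_fourModulus.1 h1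
    have h3 : (x * x' : Nˣ) ∈ squaresModFour S := by
      refine ⟨g x * g x', c x * c x', c x * s, c x * z, ?_, fun v hv ↦ ?_, fun v hv ↦
        Ideal.mul_mem_left _ _ (hz v hv), ?_⟩
      · rw [show ((c x * c x' : 𝓞 N) : N) = c x * c x' from map_mul (algebraMap (𝓞 N) N) _ _, hc, hc]
        push_cast
        ring
      · intro h
        refine (v.isPrime.mem_or_mem h).elim (hcS x v hv) ?_
        exact notMem_of_isUnit_mk (hs ▸ t.isUnit) hv
      · linear_combination c x * hz'
    rw [Subgroup.mem_subgroupOf]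
    have h4 := mul_mem h3 (inv_mem (sq_mem_squaresModFour (S := S) (x : Nˣ)))
    convert h4 using 1
    rw [Subgroup.coe_mul, Subgroup.coe_inv, pow_two]
    rw [mul_comm (x : Nˣ) x', mul_inv, ← mul_assoc, mul_inv_cancel_right, mul_comm]
  have hfin : Finite ((𝓞 N ⧸ fourModulus S)ˣ ⧸ R) := inferInstance
  have hfin' := Finite.of_injective f hf
  refine ⟨?_, ?_⟩
  · rw [Subgroup.relIndex, Subgroup.index]
    exact Nat.card_pos.ne'
  · rw [Subgroup.relIndex, Subgroup.index]
    refine (Nat.card_le_card_of_injective f hf).trans (le_trans (le_of_eq ?_)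
      (card_two_torsion_units_le S))
    have h1 := R.index_mul_card
    have h2 := (powMonoidHom 2 : (𝓞 N ⧸ fourModulus S)ˣ →* (𝓞 N ⧸ fourModulus S)ˣ).ker.index_mul_card
    rw [Subgroup.index_ker, ← h1, mul_comm R.index] at h2
    exact (Nat.eq_of_mul_eq_mul_left Nat.card_pos h2).symm


theorem isSquare_of_mem_squaresModFour (hN : ∀ v : InfinitePlace N, v.IsReal)
    {T : Finset (HeightOneSpectrum (𝓞 N))} (hST : Disjoint S T)
    (hT : (⨅ v ∈ T, localSquares v).relIndex
      ((S : Set (HeightOneSpectrum (𝓞 N))).unit N) = 2 ^ T.card)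
    (h2 : ∀ v ∉ S, (2 : 𝓞 N) ∉ v.asIdeal) (hS : HasUniformizers (S : Set (HeightOneSpectrum (𝓞 N))))
    {d : Nˣ} (hdS : d ∈ (S : Set (HeightOneSpectrum (𝓞 N))).unit N)
    (hdT : ∀ v ∈ T, d ∈ localSquares v) (hdP : ∀ v, d ∉ positiveAt (hN v))
    {P : Finset (InfinitePlace N)} (hP1 : P.card ≤ 1) {b : Nˣ}
    (hb : b ∈ squaresModFour S) (hb' : b ∈ (S ∪ T : Set (HeightOneSpectrum (𝓞 N))).unit N)
    (hbP : ∀ v, b ∈ positiveAt (hN v) ↔ v ∉ P) : IsSquare (b : N) := by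
  obtain ⟨g, c, y, z, hc, hy, hz, h⟩ := hb
  have hsq : IsSquare ((b * g ^ 2 : Nˣ) : N) := by
    refine isSquare_of_even_ord hN hST hT h2 hS hdS hdT hP1 (fun v _ ↦ hdP v) hc
      (fun v hvS hvT ↦ ?_) hy hz h fun v ↦ ?_
    · rw [v.ord_mul_sq, (Set.mem_unit_iff_ord _ b).1 hb' v (by simp [hvS, hvT]), zero_add]
      exact even_two_mul _
    · rw [← hbP v, mem_positiveAt, mem_positiveAt, Units.val_mul, map_mul, Units.val_pow_eq_pow_val,
        map_pow]
      exact mul_pos_iff_of_pos_right (even_two.pow_pos (by simp))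
  obtain ⟨a, ha⟩ := hsq
  refine ⟨a * ↑g⁻¹, ?_⟩
  rw [mul_mul_mul_comm, ← ha]
  push_cast
  field_simp

theorem squares_le_squaresModFour (X : Subgroup Nˣ) : X.squares ≤ squaresModFour S := by
  rintro x ⟨y, -, rfl⟩
  exact sq_mem_squaresModFour y

theorem relIndex_squares_squaresModFour_le (hN : ∀ v : InfinitePlace N, v.IsReal)
    {T : Finset (HeightOneSpectrum (𝓞 N))} (hST : Disjoint S T)
    (hT : (⨅ v ∈ T, localSquares v).relIndex
      ((S : Set (HeightOneSpectrum (𝓞 N))).unit N) = 2 ^ T.card)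
    (h2 : ∀ v ∉ S, (2 : 𝓞 N) ∉ v.asIdeal) (hS : HasUniformizers (S : Set (HeightOneSpectrum (𝓞 N))))
    {d : Nˣ} (hdS : d ∈ (S : Set (HeightOneSpectrum (𝓞 N))).unit N)
    (hdT : ∀ v ∈ T, d ∈ localSquares v) (hdP : ∀ v, d ∉ positiveAt (hN v)) :
    ((S ∪ T : Set (HeightOneSpectrum (𝓞 N))).unit N).squares.relIndex
      (squaresModFour S ⊓ (S ∪ T : Set (HeightOneSpectrum (𝓞 N))).unit N) ≤
      2 ^ (Fintype.card (InfinitePlace N) - 1) := by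
  classical
  set X := (S ∪ T : Set (HeightOneSpectrum (𝓞 N))).unit N with hX
  set H := squaresModFour S ⊓ X with hH
  have hfull : X.squares.relIndex X = 2 ^ (Units.rank N + Nat.card (S ∪ T : Set (HeightOneSpectrum (𝓞 N))) + 1) :=
    relIndex_squares_sUnit (S ∪ T : Set (HeightOneSpectrum (𝓞 N)))
  have hsH : X.squares ≤ H := le_inf (squares_le_squaresModFour X) (Subgroup.squares_le X)
  have hmul := Subgroup.relIndex_mul_relIndex X.squares H X hsH inf_le_right
  obtain ⟨j, -, hj⟩ := (Nat.dvd_prime_pow Nat.prime_two).1 (hfull ▸ Dvd.intro _ hmul)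
  have hne : X.squares.relIndex H ≠ 0 := by rw [hj]; positivity
  have hsquare {P : Finset (InfinitePlace N)} (hP1 : P.card ≤ 1) {b : Nˣ} (hb : b ∈ H)
      (hbP : ∀ v, b ∈ positiveAt (hN v) ↔ v ∉ P) : b ∈ X.squares :=
    mem_squares_sUnit hb.2
      (isSquare_of_mem_squaresModFour hN hST hT h2 hS hdS hdT hdP hP1 hb.1 hb.2 hbP)
  have : Nonempty (InfinitePlace N) := inferInstance
  obtain ⟨v₀⟩ := this
  let f : H ⧸ X.squares.subgroupOf H → Finset (InfinitePlace N) :=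
    fun q ↦ {v | (q.out : Nˣ) ∉ positiveAt (hN v)}
  have hf : Function.Injective f := by
    intro q q' h
    rw [← q.out_eq, ← q'.out_eq]
    refine QuotientGroup.eq.2 ?_
    rw [Subgroup.mem_subgroupOf]
    refine hsquare (P := ∅) (by simp) (SetLike.coe_mem _) fun v ↦ ?_
    have h1 : (q.out : Nˣ) ∉ positiveAt (hN v) ↔ (q'.out : Nˣ) ∉ positiveAt (hN v) := by
      have := congr_arg (v ∈ ·) h
      simpa [f] using this
    simp only [Finset.notMem_empty, not_false_eq_true, iff_true]
    rw [Subgroup.coe_mul, Subgroup.coe_inv]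
    by_cases h3 : (q.out : Nˣ) ∈ positiveAt (hN v)
    · exact mul_mem (inv_mem h3) (not_not.1 fun h4 ↦ h1.2 h4 h3)
    · have h4 := h1.1 h3
      rw [notMem_positiveAt] at h3 h4
      rw [mem_positiveAt, Units.val_mul, map_mul, Units.val_inv_eq_inv_val, map_inv₀]
      exact mul_pos_of_neg_of_neg (inv_lt_zero.2 h3) h4
  have hf' (q) : f q ≠ {v₀} := by
    intro h
    have h1 : (q.out : Nˣ) ∈ X.squares := by
      refine hsquare (P := {v₀}) (by simp) (SetLike.coe_mem _) fun v ↦ ?_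
      rw [← h]
      simp [f]
    obtain ⟨y, -, hy⟩ := h1
    have h2 : v₀ ∈ f q := by rw [h]; simp
    simp only [f, Finset.mem_filter, Finset.mem_univ, true_and, ← hy] at h2
    refine h2 ?_
    rw [mem_positiveAt]
    change 0 < InfinitePlace.embedding_of_isReal (hN v₀) ((y ^ 2 : Nˣ) : N)
    rw [Units.val_pow_eq_pow_val, map_pow]
    exact even_two.pow_pos (by simp)
  have hlt : X.squares.relIndex H < 2 ^ Fintype.card (InfinitePlace N) := by
    have : Finite (H ⧸ X.squares.subgroupOf H) := Nat.finite_of_card_ne_zero hne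
    have : Fintype (H ⧸ X.squares.subgroupOf H) := Fintype.ofFinite _
    rw [Subgroup.relIndex, Subgroup.index, Nat.card_eq_fintype_card, ← Fintype.card_finset]
    exact Fintype.card_lt_of_injective_of_notMem f hf (b := {v₀}) fun ⟨q, hq⟩ ↦ hf' q hq
  rw [hj] at hlt ⊢
  have := (Nat.pow_lt_pow_iff_right one_lt_two).1 hlt
  exact Nat.pow_le_pow_right two_pos (by omega)

theorem exists_sUnit_even_ord_sub (hN : ∀ v : InfinitePlace N, v.IsReal)
    {T : Finset (HeightOneSpectrum (𝓞 N))} (hST : Disjoint S T)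
    (hTcard : T.card = Units.rank N + S.card)
    (hT : (⨅ v ∈ T, localSquares v).relIndex
      ((S : Set (HeightOneSpectrum (𝓞 N))).unit N) = 2 ^ T.card)
    (h2 : ∀ v ∉ S, (2 : 𝓞 N) ∉ v.asIdeal) (hS : HasUniformizers (S : Set (HeightOneSpectrum (𝓞 N))))
    {d : Nˣ} (hdS : d ∈ (S : Set (HeightOneSpectrum (𝓞 N))).unit N)
    (hdT : ∀ v ∈ T, d ∈ localSquares v) (hdP : ∀ v, d ∉ positiveAt (hN v))
    (n : HeightOneSpectrum (𝓞 N) → ℤ) :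
    ∃ x ∈ (S ∪ T : Set (HeightOneSpectrum (𝓞 N))).unit N,
      ∀ v ∈ S, Even (v.ord N (.ofMul x) - n v) := by
  classical
  set X := (S ∪ T : Set (HeightOneSpectrum (𝓞 N))).unit N with hX
  set E := (ordParity S).ker with hE
  set H := squaresModFour S ⊓ X with hH
  have hr : Fintype.card (InfinitePlace N) = finrank ℚ N := by
    have : IsTotallyReal N := ⟨hN⟩
    rw [IsTotallyReal.finrank]
    exact (Fintype.card_congr (Equiv.subtypeUnivEquiv hN)).symm
  have hrank : Units.rank N + 1 = finrank ℚ N := by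
    have := finrank_pos (R := ℚ) (M := N)
    rw [Units.rank, hr]
    omega
  have hcard : Nat.card (S ∪ T : Set (HeightOneSpectrum (𝓞 N))) = S.card + T.card := by
    rw [Nat.card_coe_set_eq, ← Finset.coe_union, Set.ncard_coe_finset, Finset.card_union_of_disjoint hST]
  have hfull : X.squares.relIndex X = 2 ^ (Units.rank N + Nat.card (S ∪ T : Set (HeightOneSpectrum (𝓞 N))) + 1) :=
    relIndex_squares_sUnit (S ∪ T : Set (HeightOneSpectrum (𝓞 N)))
  have hsH : X.squares ≤ H := le_inf (squares_le_squaresModFour X) (Subgroup.squares_le X)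
  have hHE : H ≤ E ⊓ X := inf_le_inf_right _ squaresModFour_le
  have hm1 := Subgroup.relIndex_mul_relIndex X.squares H (E ⊓ X) hsH hHE
  have hm2 := Subgroup.relIndex_mul_relIndex X.squares (E ⊓ X) X (hsH.trans hHE) inf_le_right
  have hb1 := relIndex_squares_squaresModFour_le hN hST hT h2 hS hdS hdT hdP
  have hb2 : H.relIndex (E ⊓ X) ≤ 2 ^ (S.card + finrank ℚ N) := by
    obtain ⟨h0, hle⟩ := relIndex_squaresModFour_le h2
    have h1 : H.relIndex (E ⊓ X) = (squaresModFour S).relIndex (E ⊓ X) := by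
      rw [← Subgroup.inf_relIndex_right, ← Subgroup.inf_relIndex_right (squaresModFour S)]
      congr 1
      rw [hH, inf_assoc, inf_eq_right.2 (inf_le_right : E ⊓ X ≤ X)]
    rw [h1]
    exact (Subgroup.relIndex_le_of_le_right inf_le_left h0).trans hle
  have hb3 : 2 ^ S.card ≤ (E ⊓ X).relIndex X := by
    have hlow : 2 ^ (Units.rank N + Nat.card (S ∪ T : Set (HeightOneSpectrum (𝓞 N))) + 1) ≤
        2 ^ (Fintype.card (InfinitePlace N) - 1) * 2 ^ (S.card + finrank ℚ N) *
          (E ⊓ X).relIndex X := by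
      rw [← hfull, ← hm2, ← hm1]
      exact Nat.mul_le_mul_right _ (Nat.mul_le_mul hb1 hb2)
    refine Nat.le_of_mul_le_mul_left (le_trans (le_of_eq ?_) hlow)
      (by positivity)
    rw [← pow_add, ← pow_add, hcard, hTcard, hr]
    congr 1
    omega
  rw [Subgroup.inf_relIndex_right, hE, Subgroup.relIndex_ker] at hb3
  have htop : X.map (ordParity S) = ⊤ := by
    refine Subgroup.eq_top_of_le_card _ (le_trans (le_of_eq ?_) hb3)
    rw [Nat.card_eq_fintype_card, Fintype.card_multiplicative]
    simp
  obtain ⟨x, hx, hxn⟩ : Multiplicative.ofAdd (fun v : S ↦ (n v : ZMod 2)) ∈ X.map (ordParity S) :=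
    htop ▸ Subgroup.mem_top _
  refine ⟨x, hx, fun v hv ↦ ?_⟩
  have h1 := congr_fun (congr_arg Multiplicative.toAdd hxn) ⟨v, hv⟩
  rw [ordParity_apply, toAdd_ofAdd, ← sub_eq_zero, ← Int.cast_sub,
    ZMod.intCast_zmod_eq_zero_iff_dvd] at h1
  exact even_iff_two_dvd.2 h1

end Parity

section ClassGroupNorm

variable {F K : Type*} [Field F] [NumberField F] [Field K] [NumberField K] [Algebra F K]

theorem relNormIdeal_eq_relNorm (I : Ideal (𝓞 K)) : relNormIdeal F I = Ideal.relNorm (𝓞 F) I := by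
  rw [relNormIdeal, Ideal.relNorm_apply]
  congr 1
  ext y
  refine exists_congr fun x ↦ and_congr_right fun _ ↦ ?_
  rw [← Algebra.algebraMap_intNorm (A := 𝓞 F) (B := 𝓞 K) (K := F) (L := K),
    (IsFractionRing.injective (𝓞 F) F).eq_iff, eq_comm]

theorem exists_integer_sq_eq [Algebra.IsQuadraticExtension F K] :
    ∃ (d : 𝓞 F) (δ : K), ¬ IsSquare (d : F) ∧ δ ^ 2 = algebraMap F K d := by
  have hc : Nat.card Gal(K/F) = 2 := by
    rw [IsGalois.card_aut_eq_finrank, Algebra.IsQuadraticExtension.finrank_eq_two]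
  obtain ⟨σ, hσ, huniq⟩ := (Nat.card_eq_two_iff' (1 : Gal(K/F))).1 hc
  obtain ⟨α, hα⟩ : ∃ α, σ α ≠ α := by
    by_contra! h
    exact hσ (AlgEquiv.ext h)
  have hσσ : σ (σ α) = α := by
    rw [← AlgEquiv.mul_apply, show σ * σ = 1 from ?_, AlgEquiv.one_apply]
    by_contra h
    exact hσ (mul_eq_left.1 (huniq _ h))
  set β := α - σ α with hβ
  have hβ0 : β ≠ 0 := sub_ne_zero.2 hα.symm
  have hσβ : σ β = -β := by rw [hβ, map_sub, hσσ, neg_sub]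
  obtain ⟨c, hcβ⟩ := (IsGalois.mem_bot_iff_fixed (F := F) (β ^ 2)).2 fun f ↦ by
    by_cases hf : f = 1
    · rw [hf, AlgEquiv.one_apply]
    · rw [huniq f hf, map_pow, hσβ, neg_sq]
  change algebraMap F K c = β ^ 2 at hcβ
  have hc0 : c ≠ 0 := by
    rintro rfl
    rw [map_zero] at hcβ
    exact hβ0 (pow_eq_zero_iff two_ne_zero |>.1 hcβ.symm)
  obtain ⟨g, d, hd⟩ := exists_mul_sq_eq_integer (Units.mk0 c hc0)
  refine ⟨d, β * algebraMap F K g, ?_, ?_⟩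
  · rintro ⟨a, ha⟩
    have h1 : (algebraMap F K (a / g)) ^ 2 = β ^ 2 := by
      rw [← map_pow, ← hcβ, div_pow, sq a, ← ha, hd]
      congr 1
      field_simp
      rfl
    have h2 : σ β = β := by
      obtain h | h := sq_eq_sq_iff_eq_or_eq_neg.1 h1
      · rw [← h, AlgEquiv.commutes]
      · rw [← neg_eq_iff_eq_neg.2 h, map_neg, AlgEquiv.commutes]
    rw [hσβ] at h2
    exact hβ0 (self_eq_neg.1 h2.symm)
  · rw [hd, map_mul, map_pow, mul_pow, ← hcβ]
    rfl

theorem exists_relNorm_eq_of_sq_sub_mem [Algebra.IsQuadraticExtension F K] {d : 𝓞 F} {δ : K}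
    (hd : ¬ IsSquare (d : F)) (hδ : δ ^ 2 = algebraMap F K d) {v : HeightOneSpectrum (𝓞 F)}
    (h2 : (2 : 𝓞 F) ∉ v.asIdeal) (hdv : d ∉ v.asIdeal) {e : 𝓞 F} (he : e ^ 2 - d ∈ v.asIdeal) :
    ∃ Q : Ideal (𝓞 K), Ideal.relNorm (𝓞 F) Q = v.asIdeal := by
  have hev : e ∉ v.asIdeal := by
    intro h
    refine hdv ?_
    have := sub_mem (Ideal.pow_mem_of_mem _ h 2 two_pos) he
    rwa [sub_sub_cancel] at this
  have h4d : ((4 * d : 𝓞 F) : F) = 4 * d := by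
    change algebraMap (𝓞 F) F (4 * d) = _
    rw [map_mul, map_ofNat]
  obtain ⟨w, w', hne, hw, hw'⟩ := exists_two_primes_above (L := K) (θ := 2 * δ) (c := 4 * d)
    (y := 2 * e) (z := e ^ 2 - d) (v := v)
    (by
      rw [h4d]
      rintro ⟨a, ha⟩
      exact hd ⟨a / 2, by linear_combination ha / 4⟩)
    (by rw [h4d, mul_pow, hδ, map_mul, map_ofNat]; norm_num)
    (fun h ↦ (v.isPrime.mem_or_mem h).elim h2 hev) he (by ring)
  refine ⟨w.asIdeal, ?_⟩
  have hN : Ideal.absNorm w.asIdeal = Ideal.absNorm v.asIdeal :=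
    absNorm_eq_of_ne (P' := w'.asIdeal) v.ne_bot (congr_arg HeightOneSpectrum.asIdeal hw)
      (congr_arg HeightOneSpectrum.asIdeal hw') fun h ↦ hne (HeightOneSpectrum.ext h)
  have hlies : w.asIdeal.LiesOver v.asIdeal := ⟨(congr_arg HeightOneSpectrum.asIdeal hw).symm⟩
  have h1 := Ideal.absNorm_pow_inertiaDeg v.asIdeal w.asIdeal
  rw [hN] at h1
  have hf : w.asIdeal.inertiaDeg (𝓞 F) = 1 :=
    Nat.pow_right_injective (two_le_absNorm v) (by simpa using h1)
  rw [Ideal.relNorm_eq_pow_of_isMaximal w.asIdeal v.asIdeal, hf, pow_one]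

open Classical in
theorem exists_relNorm_eq [Algebra.IsQuadraticExtension F K] {I : Ideal (𝓞 F)} (hI : I ≠ 0)
    (h : ∀ v : HeightOneSpectrum (𝓞 F),
      Even ((Associates.mk v.asIdeal).count (Associates.mk I).factors) ∨
      ∃ Q : Ideal (𝓞 K), Ideal.relNorm (𝓞 F) Q = v.asIdeal) :
    ∃ A : Ideal (𝓞 K), Ideal.relNorm (𝓞 F) A = I := by
  rw [← Ideal.finprod_heightOneSpectrum_factorization hI]
  refine finprod_induction (fun J ↦ ∃ A : Ideal (𝓞 K), Ideal.relNorm (𝓞 F) A = J)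
    ⟨1, map_one _⟩ ?_ fun v ↦ ?_
  · rintro _ _ ⟨A, rfl⟩ ⟨B, rfl⟩
    exact ⟨A * B, map_mul _ _ _⟩
  · obtain ⟨k, hk⟩ | ⟨Q, hQ⟩ := h v
    · refine ⟨(v.asIdeal ^ k).map (algebraMap (𝓞 F) (𝓞 K)), ?_⟩
      have hrank : finrank (𝓞 F) (𝓞 K) = 2 := by
        rw [← IsFractionRing.finrank_eq (𝓞 F) F (𝓞 K) K,
          Algebra.IsQuadraticExtension.finrank_eq_two]
      rw [Ideal.relNorm_algebraMap, hrank, HeightOneSpectrum.maxPowDividing, hk, ← pow_mul, mul_two]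
    · exact ⟨Q ^ (Associates.mk v.asIdeal).count (Associates.mk I).factors, by
        rw [map_pow, hQ, HeightOneSpectrum.maxPowDividing]⟩

open Classical in
theorem count_span_singleton_eq_ord (v : HeightOneSpectrum (𝓞 F)) {a : 𝓞 F} {x : Fˣ}
    (hx : (a : F) = x) :
    ((Associates.mk v.asIdeal).count (Associates.mk (Ideal.span {a} : Ideal (𝓞 F))).factors : ℤ) =
      v.ord F (.ofMul x) := by
  have ha : a ≠ 0 := by
    rintro rfl
    exact x.ne_zero (by rw [← hx]; exact map_zero (algebraMap (𝓞 F) F))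
  have h1 : v.intValuation a = v.valuation F (x : F) := by
    rw [← hx]
    exact (v.valuation_of_algebraMap a).symm
  rw [v.intValuation_if_neg ha, v.valuation_eq_exp_ord, WithZero.exp_inj, neg_inj] at h1
  exact h1

theorem exists_finite_representatives : ∃ (S : Finset (HeightOneSpectrum (𝓞 F)))
    (J : ClassGroup (𝓞 F) → (Ideal (𝓞 F))⁰), (∀ C, ClassGroup.mk0 (J C) = C) ∧
    ∀ C, ∀ v ∉ S, ¬ (J C : Ideal (𝓞 F)) ≤ v.asIdeal := by
  classical
  choose J hJ using ClassGroup.mk0_surjective (R := 𝓞 F)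
  have hfin (C) : {v : HeightOneSpectrum (𝓞 F) | (J C : Ideal (𝓞 F)) ≤ v.asIdeal}.Finite := by
    refine (Ideal.finite_factors (nonZeroDivisors.coe_ne_zero (J C))).subset fun v hv ↦ ?_
    exact Ideal.dvd_iff_le.2 hv
  refine ⟨(Set.finite_iUnion hfin).toFinset, J, hJ, fun C v hv h ↦ hv ?_⟩
  simp only [Set.Finite.mem_toFinset, Set.mem_iUnion]
  exact ⟨C, h⟩

theorem hasUniformizers_of_representatives {S : Set (HeightOneSpectrum (𝓞 F))}
    {J : ClassGroup (𝓞 F) → (Ideal (𝓞 F))⁰} (hJ : ∀ C, ClassGroup.mk0 (J C) = C)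
    (hJS : ∀ C, ∀ v ∉ S, ¬ (J C : Ideal (𝓞 F)) ≤ v.asIdeal) : HasUniformizers S := by
  intro v hv
  let V : (Ideal (𝓞 F))⁰ := ⟨v.asIdeal, mem_nonZeroDivisors_of_ne_zero v.ne_bot⟩
  set I := J (ClassGroup.mk0 V)⁻¹ with hI
  have h1 : ClassGroup.mk0 (V * I) = 1 := by rw [map_mul, hJ, mul_inv_cancel]
  obtain ⟨a, ha⟩ := (ClassGroup.mk0_eq_one_iff (V * I).2).1 h1
  change v.asIdeal * (I : Ideal (𝓞 F)) = Ideal.span {a} at ha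
  have hI0 : (I : Ideal (𝓞 F)) ≠ 0 := nonZeroDivisors.coe_ne_zero I
  have ha0 : (a : F) ≠ 0 := by
    intro h
    have : a = 0 := RingOfIntegers.ext h
    rw [this, Ideal.span_singleton_eq_bot.2 rfl] at ha
    exact mul_ne_zero v.ne_bot hI0 ha
  have hmem (w : HeightOneSpectrum (𝓞 F)) (n : ℕ) :
      (n : ℤ) ≤ w.ord F (.ofMul (Units.mk0 (a : F) ha0)) ↔
        v.asIdeal * (I : Ideal (𝓞 F)) ≤ w.asIdeal ^ n := by
    rw [w.le_ord_iff (Units.mk0 (a : F) ha0) (y := a) rfl n, ha, Ideal.span_singleton_le_iff_mem]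
  refine ⟨Units.mk0 (a : F) ha0, ?_, fun w hw hwv ↦ ?_⟩
  · have h1 : v.asIdeal * (I : Ideal (𝓞 F)) ≤ v.asIdeal ^ 1 := by
      rw [pow_one]
      exact Ideal.dvd_iff_le.1 (dvd_mul_right _ _)
    have h2 := (hmem v 1).2 h1
    have h3 := (hmem v 2).not.2 fun h ↦ by
      rw [pow_two, ← Ideal.dvd_iff_le] at h
      exact hJS _ v hv (Ideal.dvd_iff_le.1 ((mul_dvd_mul_iff_left v.ne_bot).1 h))
    push_cast at h2 h3
    omega
  · have h2 := (hmem w 0).2 (by rw [pow_zero, Ideal.one_eq_top]; exact le_top)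
    have h3 := (hmem w 1).not.2 fun h ↦ by
      rw [pow_one] at h
      obtain h | h := w.isPrime.mul_le.1 h
      · exact hwv (HeightOneSpectrum.ext (v.isMaximal.eq_of_le w.isPrime.ne_top h).symm)
      · exact hJS _ w hw h
    push_cast at h2 h3
    omega

theorem notMem_positiveAt_of_isComplex [Algebra.IsQuadraticExtension F K]
    (hF : ∀ v : InfinitePlace F, v.IsReal) (hK : ∀ v : InfinitePlace K, v.IsComplex) {d : Fˣ} {δ : K}
    (hd : ¬ IsSquare (d : F)) (hδ : δ ^ 2 = algebraMap F K d) (v : InfinitePlace F) :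
    d ∉ positiveAt (hF v) := by
  intro h
  obtain ⟨w, hw⟩ := InfinitePlace.comap_surjective (K := K) v
  obtain h1 | h1 := InfinitePlace.isUnramified_iff.1 (isUnramifiedIn_of_pos hF hd hδ h w hw)
  · exact InfinitePlace.not_isReal_iff_isComplex.2 (hK w) h1
  · exact InfinitePlace.not_isReal_iff_isComplex.2 h1 (hF _)

end ClassGroupNorm

/-- The relative norm induces a surjection from the ideal class group of `K`
onto the ideal class group of `F`: every ideal class `c` of `𝓞 F` is the class of
`N_{K/F}(I)` for some nonzero ideal `I` of `𝓞 K`. -/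
theorem relNorm_classGroup_surjective
    (F K : Type*) [Field F] [Field K] [NumberField F] [NumberField K] [Algebra F K]
    (hF : ∀ v : InfinitePlace F, v.IsReal)
    (hK : ∀ v : InfinitePlace K, v.IsComplex)
    (hdeg : Module.finrank F K = 2) :
    ∀ c : ClassGroup (𝓞 F), ∃ I : Ideal (𝓞 K), I ≠ 0 ∧
      ∃ hN : relNormIdeal F I ∈ (Ideal (𝓞 F))⁰,
        ClassGroup.mk0 ⟨relNormIdeal F I, hN⟩ = c := by
  classical
  intro C
  have : Algebra.IsQuadraticExtension F K := { finrank_eq_two' := hdeg }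
  obtain ⟨d, δ, hd, hδ⟩ := exists_integer_sq_eq (F := F) (K := K)
  obtain ⟨S₀, J, hJ, hJS₀⟩ := exists_finite_representatives (F := F)
  have hd0 : d ≠ 0 := by
    rintro rfl
    exact hd ⟨0, by simp⟩
  have hd0' : (d : F) ≠ 0 := fun h ↦ hd0 (RingOfIntegers.ext h)
  set S : Finset (HeightOneSpectrum (𝓞 F)) := S₀ ∪ (finite_setOf_mem_asIdeal hd0).toFinset ∪
    (finite_setOf_mem_asIdeal (two_ne_zero (α := 𝓞 F))).toFinset with hS
  have h2 (v : HeightOneSpectrum (𝓞 F)) (hv : v ∉ S) : (2 : 𝓞 F) ∉ v.asIdeal := fun h ↦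
    hv (by simp [hS, h])
  have hdS (v : HeightOneSpectrum (𝓞 F)) (hv : v ∉ S) : d ∉ v.asIdeal := fun h ↦
    hv (by simp [hS, h])
  have hJS (C) (v : HeightOneSpectrum (𝓞 F)) (hv : v ∉ S) : ¬ (J C : Ideal (𝓞 F)) ≤ v.asIdeal :=
    hJS₀ C v fun h ↦ hv (by simp [hS, h])
  have hU : HasUniformizers (S : Set (HeightOneSpectrum (𝓞 F))) :=
    hasUniformizers_of_representatives hJ fun C v hv ↦ hJS C v (by simpa using hv)
  set d' : Fˣ := Units.mk0 (d : F) hd0' with hd'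
  have hdU : d' ∈ (S : Set (HeightOneSpectrum (𝓞 F))).unit F :=
    (Set.mem_unit_iff_ord _ _).2 fun v hv ↦
      (v.ord_eq_zero_iff d' (y := d) rfl).2 (hdS v (by simpa using hv))
  obtain ⟨T, hTcard, hST, hT, hTidx⟩ :=
    exists_finset_relIndex_localSquares S hd hδ (d' := d') rfl hdU (Units.rank F + S.card) le_rfl
  obtain ⟨x, hxU, hx⟩ := exists_sUnit_even_ord_sub hF hST hTcard (hTcard ▸ hTidx) h2 hU hdU
    (fun v hv ↦ (hT v hv).1)
    (notMem_positiveAt_of_isComplex hF hK (d := d') hd hδ)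
    fun v ↦ ((Associates.mk v.asIdeal).count (Associates.mk (J C : Ideal (𝓞 F))).factors : ℤ)
  obtain ⟨g, a, ha⟩ := exists_mul_sq_eq_integer x
  have ha' : (a : F) = (x * g ^ 2 : Fˣ) := by rw [ha]; push_cast; rfl
  have ha0 : a ≠ 0 := by
    rintro rfl
    exact (x * g ^ 2).ne_zero (by rw [← ha']; exact map_zero (algebraMap (𝓞 F) F))
  have hJ0 : (J C : Ideal (𝓞 F)) ≠ 0 := nonZeroDivisors.coe_ne_zero _
  have hs0 : Ideal.span {a} ≠ 0 := by simpa using ha0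
  obtain ⟨A, hA⟩ := exists_relNorm_eq (K := K) (mul_ne_zero hs0 hJ0) fun v ↦ by
    by_cases hvT : v ∈ T
    · have hvS : v ∉ S := fun h ↦ Finset.disjoint_left.1 hST h hvT
      obtain ⟨e, he⟩ := (hT v hvT).2
      exact .inr (exists_relNorm_eq_of_sq_sub_mem hd hδ (h2 v hvS) (hdS v hvS) he)
    · left
      rw [← Associates.mk_mul_mk, Associates.count_mul (Associates.mk_ne_zero.2 hs0)
        (Associates.mk_ne_zero.2 hJ0) (Associates.irreducible_mk.2 v.irreducible),
        ← Int.even_coe_nat, Nat.cast_add, count_span_singleton_eq_ord v ha', v.ord_mul_sq]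
      by_cases hvS : v ∈ S
      · have := hx v hvS
        rw [Int.even_sub] at this
        rw [add_right_comm, Int.even_add]
        simp [Int.even_add, this]
      · rw [(Set.mem_unit_iff_ord _ x).1 hxU v (by simp [hvS, hvT])]
        have : (Associates.mk v.asIdeal).count (Associates.mk (J C : Ideal (𝓞 F))).factors = 0 := by
          by_contra h
          exact hJS C v hvS
            (Ideal.dvd_iff_le.1 ((Associates.count_ne_zero_iff_dvd hJ0 v.irreducible).1 h))
        rw [this]
        simp
  have hN : relNormIdeal F A = Ideal.span {a} * (J C : Ideal (𝓞 F)) := by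
    rw [relNormIdeal_eq_relNorm, hA]
  refine ⟨A, ?_, ?_, ?_⟩
  · rintro rfl
    rw [map_zero] at hA
    exact mul_ne_zero hs0 hJ0 hA.symm
  · rw [hN]
    exact mem_nonZeroDivisors_of_ne_zero (mul_ne_zero hs0 hJ0)
  · refine (ClassGroup.mk0_eq_mk0_iff.2 ?_).trans (hJ C)
    exact ⟨1, a, one_ne_zero, ha0, by simp [hN]⟩
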